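/- There are no natural numbers n, m with n ≥ 8 and m ≥ 12 satisfying C(n, 4) = C(m, 6), where C denotes the binomial coefficient. -/

import Mathlib

/-- The order `ℤ ⊕ ℤξ ⊕ ℤζ ⊕ ℤξζ`, where `ξ² = 15ζ` and `ζ² = 2cζ - 4xξ + e`; thus `ξ` is a root of
`T⁴ - 30cT² + 900xT - 225e`. -/
@[ext]
structure QuarticOrder (c x e : ℤ) where
  /-- coordinate of `1` -/
  a₀ : ℤ
  /-- coordinate of `ξ` -/
  a₁ : ℤ
  /-- coordinate of `ζ` -/
  a₂ : ℤ
  /-- coordinate of `ξζ` -/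
  a₃ : ℤ

namespace QuarticOrder

variable {c x e : ℤ}

instance : Fact (Nat.Prime 5) := ⟨by norm_num⟩

instance : Zero (QuarticOrder c x e) := ⟨⟨0, 0, 0, 0⟩⟩
instance : One (QuarticOrder c x e) := ⟨⟨1, 0, 0, 0⟩⟩
instance : Add (QuarticOrder c x e) :=
  ⟨fun u v => ⟨u.a₀ + v.a₀, u.a₁ + v.a₁, u.a₂ + v.a₂, u.a₃ + v.a₃⟩⟩
instance : Neg (QuarticOrder c x e) := ⟨fun u => ⟨-u.a₀, -u.a₁, -u.a₂, -u.a₃⟩⟩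
instance : Mul (QuarticOrder c x e) :=
  ⟨fun u v =>
    ⟨u.a₀ * v.a₀ + e * (u.a₂ * v.a₂) + 15 * e * (u.a₁ * v.a₃ + u.a₃ * v.a₁)
        + 30 * c * e * (u.a₃ * v.a₃),
      u.a₀ * v.a₁ + u.a₁ * v.a₀ - 4 * x * (u.a₂ * v.a₂) - 60 * x * (u.a₁ * v.a₃ + u.a₃ * v.a₁)
        + e * (u.a₂ * v.a₃ + u.a₃ * v.a₂) - 120 * c * x * (u.a₃ * v.a₃),
      u.a₀ * v.a₂ + u.a₂ * v.a₀ + 15 * (u.a₁ * v.a₁) + 2 * c * (u.a₂ * v.a₂)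
        + 30 * c * (u.a₁ * v.a₃ + u.a₃ * v.a₁) - 60 * x * (u.a₂ * v.a₃ + u.a₃ * v.a₂)
        + 15 * (e + 4 * c ^ 2) * (u.a₃ * v.a₃),
      u.a₀ * v.a₃ + u.a₃ * v.a₀ + u.a₁ * v.a₂ + u.a₂ * v.a₁
        + 2 * c * (u.a₂ * v.a₃ + u.a₃ * v.a₂) - 60 * x * (u.a₃ * v.a₃)⟩⟩

theorem zero_def : (0 : QuarticOrder c x e) = ⟨0, 0, 0, 0⟩ := rfl
theorem one_def : (1 : QuarticOrder c x e) = ⟨1, 0, 0, 0⟩ := rfl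
theorem mk_add (p q r s p' q' r' s' : ℤ) :
    (⟨p, q, r, s⟩ : QuarticOrder c x e) + ⟨p', q', r', s'⟩ = ⟨p + p', q + q', r + r', s + s'⟩ := rfl
theorem mk_neg (p q r s : ℤ) :
    -(⟨p, q, r, s⟩ : QuarticOrder c x e) = ⟨-p, -q, -r, -s⟩ := rfl
theorem mk_mul (p q r s p' q' r' s' : ℤ) :
    (⟨p, q, r, s⟩ : QuarticOrder c x e) * ⟨p', q', r', s'⟩ =
      ⟨p * p' + e * (r * r') + 15 * e * (q * s' + s * q') + 30 * c * e * (s * s'),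
        p * q' + q * p' - 4 * x * (r * r') - 60 * x * (q * s' + s * q') + e * (r * s' + s * r')
          - 120 * c * x * (s * s'),
        p * r' + r * p' + 15 * (q * q') + 2 * c * (r * r') + 30 * c * (q * s' + s * q')
          - 60 * x * (r * s' + s * r') + 15 * (e + 4 * c ^ 2) * (s * s'),
        p * s' + s * p' + q * r' + r * q' + 2 * c * (r * s' + s * r') - 60 * x * (s * s')⟩ := rfl

instance : CommRing (QuarticOrder c x e) where
  add_assoc u v w := by cases u; cases v; cases w; simp only [mk_add, add_assoc]
  zero_add u := by cases u; simp only [zero_def, mk_add, zero_add]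
  add_zero u := by cases u; simp only [zero_def, mk_add, add_zero]
  add_comm u v := by cases u; cases v; simp only [mk_add, add_comm]
  neg_add_cancel u := by cases u; simp only [zero_def, mk_neg, mk_add, neg_add_cancel]
  mul_assoc u v w := by
    cases u; cases v; cases w; simp only [mk_mul, mk.injEq]; refine ⟨?_, ?_, ?_, ?_⟩ <;> ring
  one_mul u := by
    cases u; simp only [one_def, mk_mul, mk.injEq]; refine ⟨?_, ?_, ?_, ?_⟩ <;> ring
  mul_one u := by
    cases u; simp only [one_def, mk_mul, mk.injEq]; refine ⟨?_, ?_, ?_, ?_⟩ <;> ring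
  zero_mul u := by
    cases u; simp only [zero_def, mk_mul, mk.injEq]; refine ⟨?_, ?_, ?_, ?_⟩ <;> ring
  mul_zero u := by
    cases u; simp only [zero_def, mk_mul, mk.injEq]; refine ⟨?_, ?_, ?_, ?_⟩ <;> ring
  left_distrib u v w := by
    cases u; cases v; cases w
    simp only [mk_mul, mk_add, mk.injEq]; refine ⟨?_, ?_, ?_, ?_⟩ <;> ring
  right_distrib u v w := by
    cases u; cases v; cases w
    simp only [mk_mul, mk_add, mk.injEq]; refine ⟨?_, ?_, ?_, ?_⟩ <;> ring
  mul_comm u v := by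
    cases u; cases v; simp only [mk_mul, mk.injEq]; refine ⟨?_, ?_, ?_, ?_⟩ <;> ring
  nsmul := nsmulRec
  zsmul := zsmulRec
  natCast n := ⟨n, 0, 0, 0⟩
  natCast_zero := rfl
  natCast_succ n := by simp [one_def, mk_add]
  intCast n := ⟨n, 0, 0, 0⟩
  intCast_ofNat _ := rfl
  intCast_negSucc n := by
    change (⟨Int.negSucc n, 0, 0, 0⟩ : QuarticOrder c x e) = -⟨((n + 1 : ℕ) : ℤ), 0, 0, 0⟩
    simp [mk_neg, Int.negSucc_eq]

theorem intCast_def (n : ℤ) : (n : QuarticOrder c x e) = ⟨n, 0, 0, 0⟩ := rfl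
theorem intCast_mul_mk (n p q r s : ℤ) :
    (n : QuarticOrder c x e) * ⟨p, q, r, s⟩ = ⟨n * p, n * q, n * r, n * s⟩ := by
  simp only [intCast_def, mk_mul, mk.injEq]; refine ⟨?_, ?_, ?_, ?_⟩ <;> ring

/-- `u` is congruent to an integer prime to `5`, up to `5 ^ j` times an element of
`ℤξ + 5ℤζ + ℤξζ`; relative to that integer, the coordinates of this element modulo `5` are `v`. -/
def NearInt (u : QuarticOrder c x e) (j : ℕ) (v : Fin 3 → ZMod 5) : Prop :=
  (u.a₀ : ZMod 5) ≠ 0 ∧ ∃ w₁ w₂ w₃ : ℤ, u.a₁ = 5 ^ j * w₁ ∧ u.a₂ = 5 ^ (j + 1) * w₂ ∧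
    u.a₃ = 5 ^ j * w₃ ∧ (w₁ : ZMod 5) = u.a₀ * v 0 ∧ (w₂ : ZMod 5) = u.a₀ * v 1 ∧
    (w₃ : ZMod 5) = u.a₀ * v 2

theorem nearInt_one (j : ℕ) : NearInt (1 : QuarticOrder c x e) j 0 :=
  ⟨by simp [one_def], 0, 0, 0, by simp [one_def]⟩

theorem five_eq_zero : (5 : ZMod 5) = 0 := by decide

theorem NearInt.mul {u u' : QuarticOrder c x e} {j : ℕ} {v v' : Fin 3 → ZMod 5} (hj : j ≠ 0)
    (h : NearInt u j v) (h' : NearInt u' j v') : NearInt (u * u') j (v + v') := by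
  obtain ⟨j, rfl⟩ := Nat.exists_eq_add_of_le' (Nat.one_le_iff_ne_zero.2 hj)
  obtain ⟨p, q, r, s⟩ := u
  obtain ⟨p', q', r', s'⟩ := u'
  obtain ⟨h0, w₁, w₂, w₃, rfl, rfl, rfl, h1, h2, h3⟩ := h
  obtain ⟨h0', w₁', w₂', w₃', rfl, rfl, rfl, h1', h2', h3'⟩ := h'
  dsimp only at *
  rw [mk_mul]
  have h5 := five_eq_zero
  have e0 : ((p * p' + e * (5 ^ (j + 1 + 1) * w₂ * (5 ^ (j + 1 + 1) * w₂'))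
      + 15 * e * (5 ^ (j + 1) * w₁ * (5 ^ (j + 1) * w₃') + 5 ^ (j + 1) * w₃ * (5 ^ (j + 1) * w₁'))
      + 30 * c * e * (5 ^ (j + 1) * w₃ * (5 ^ (j + 1) * w₃')) : ℤ) : ZMod 5) = p * p' := by
    push_cast [pow_succ, h5]; ring
  refine ⟨?_, p * w₁' + w₁ * p' - 4 * x * (5 ^ (j + 3) * (w₂ * w₂'))
      - 60 * x * (5 ^ (j + 1) * (w₁ * w₃' + w₃ * w₁'))
      + e * (5 ^ (j + 2) * (w₂ * w₃' + w₃ * w₂')) - 120 * c * x * (5 ^ (j + 1) * (w₃ * w₃')),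
    p * w₂' + w₂ * p' + 3 * 5 ^ (j + 1) * (w₁ * w₁') + 2 * c * (5 ^ (j + 2) * (w₂ * w₂'))
      + 6 * c * (5 ^ (j + 1) * (w₁ * w₃' + w₃ * w₁')) - 60 * x * (5 ^ (j + 1) *
      (w₂ * w₃' + w₃ * w₂')) + 3 * (e + 4 * c ^ 2) * (5 ^ (j + 1) * (w₃ * w₃')),
    p * w₃' + w₃ * p' + 5 ^ (j + 2) * (w₁ * w₂' + w₂ * w₁') + 2 * c * (5 ^ (j + 2) *
      (w₂ * w₃' + w₃ * w₂')) - 60 * x * (5 ^ (j + 1) * (w₃ * w₃')), ?_, ?_, ?_, ?_, ?_, ?_⟩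
  · rw [e0]; exact mul_ne_zero h0 h0'
  · ring
  · ring
  · ring
  all_goals
    rw [e0]; push_cast [pow_succ, h5, h1, h2, h3, h1', h2', h3', Pi.add_apply]; ring

theorem NearInt.pow {u : QuarticOrder c x e} {j : ℕ} {v : Fin 3 → ZMod 5} (hj : j ≠ 0)
    (h : NearInt u j v) (n : ℕ) : NearInt (u ^ n) j (n • v) := by
  induction n with
  | zero => simpa using nearInt_one j
  | succ n ih => rw [pow_succ, succ_nsmul]; exact ih.mul hj h

theorem NearInt.unique {u : QuarticOrder c x e} {j : ℕ} {v v' : Fin 3 → ZMod 5}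
    (h : NearInt u j v) (h' : NearInt u j v') : v = v' := by
  obtain ⟨h0, w₁, w₂, w₃, e1, e2, e3, h1, h2, h3⟩ := h
  obtain ⟨-, w₁', w₂', w₃', e1', e2', e3', h1', h2', h3'⟩ := h'
  have h5 : ∀ k : ℕ, (5 : ℤ) ^ k ≠ 0 := fun k => by positivity
  have f1 : w₁ = w₁' := mul_left_cancel₀ (h5 _) (e1.symm.trans e1')
  have f2 : w₂ = w₂' := mul_left_cancel₀ (h5 _) (e2.symm.trans e2')
  have f3 : w₃ = w₃' := mul_left_cancel₀ (h5 _) (e3.symm.trans e3')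
  subst f1 f2 f3
  funext i
  fin_cases i
  · exact mul_left_cancel₀ h0 (h1.symm.trans h1')
  · exact mul_left_cancel₀ h0 (h2.symm.trans h2')
  · exact mul_left_cancel₀ h0 (h3.symm.trans h3')

theorem NearInt.of_lt {u : QuarticOrder c x e} {j k : ℕ} {v : Fin 3 → ZMod 5}
    (h : NearInt u k v) (hjk : j < k) : NearInt u j 0 := by
  obtain ⟨d, rfl⟩ := Nat.exists_eq_add_of_lt hjk
  obtain ⟨h0, w₁, w₂, w₃, e1, e2, e3, -⟩ := h
  have h5 := five_eq_zero
  refine ⟨h0, 5 ^ (d + 1) * w₁, 5 ^ (d + 1) * w₂, 5 ^ (d + 1) * w₃, ?_, ?_, ?_, ?_, ?_, ?_⟩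
  · rw [e1]; ring
  · rw [e2]; ring
  · rw [e3]; ring
  all_goals push_cast [pow_succ, h5]; simp

theorem five_dvd_mul {u v : QuarticOrder c x e} (hu : 5 ∣ u.a₂) (hv : 5 ∣ v.a₂) :
    5 ∣ (u * v).a₂ := by
  obtain ⟨p, q, r, s⟩ := u
  obtain ⟨p', q', r', s'⟩ := v
  obtain ⟨w, rfl : r = 5 * w⟩ := hu
  obtain ⟨w', rfl : r' = 5 * w'⟩ := hv
  refine ⟨p * w' + w * p' + 3 * (q * q') + 10 * c * (w * w') + 6 * c * (q * s' + s * q')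
    - 60 * x * (w * s' + s * w') + 3 * (e + 4 * c ^ 2) * (s * s'), ?_⟩
  simp only [mk_mul]; ring

theorem NearInt.pow_five {u : QuarticOrder c x e} {j : ℕ} {v : Fin 3 → ZMod 5} (hj : j ≠ 0)
    (h : NearInt u j v) : NearInt (u ^ 5) (j + 1) v := by
  obtain ⟨j, rfl⟩ := Nat.exists_eq_add_of_le' (Nat.one_le_iff_ne_zero.2 hj)
  obtain ⟨s, q, r, t⟩ := u
  obtain ⟨h0, w₁, w₂, w₃, rfl, rfl, rfl, h1, h2, h3⟩ := h
  dsimp only at h0 h1 h2 h3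
  have h5 := five_eq_zero
  set y : QuarticOrder c x e := ⟨0, w₁, 5 * w₂, w₃⟩ with hy
  have y1 : 5 ∣ y.a₂ := Dvd.intro _ rfl
  have y2 := five_dvd_mul y1 y1
  have y3 := five_dvd_mul y2 y1
  have y4 := five_dvd_mul y3 y1
  have y5 := five_dvd_mul y4 y1
  have hu : (⟨s, 5 ^ (j + 1) * w₁, 5 ^ (j + 1 + 1) * w₂, 5 ^ (j + 1) * w₃⟩ : QuarticOrder c x e)
      = (s : QuarticOrder c x e) + ((5 ^ (j + 1) : ℤ) : QuarticOrder c x e) * y := by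
    rw [hy, intCast_mul_mk, intCast_def, mk_add]; congr 1 <;> ring
  have key : ∃ z : QuarticOrder c x e, 5 ∣ z.a₂ ∧
      ((s : QuarticOrder c x e) + ((5 ^ (j + 1) : ℤ) : QuarticOrder c x e) * y) ^ 5 =
        ((s ^ 5 : ℤ) : QuarticOrder c x e) + ((5 ^ (j + 2) : ℤ) : QuarticOrder c x e) *
          (((s ^ 4 : ℤ) : QuarticOrder c x e) * y + ((5 : ℤ) : QuarticOrder c x e) * z) := by
    refine ⟨((5 ^ j * 2 * s ^ 3 : ℤ) : QuarticOrder c x e) * (y * y)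
      + ((5 ^ (2 * j + 1) * 2 * s ^ 2 : ℤ) : QuarticOrder c x e) * (y * y * y)
      + ((5 ^ (3 * j + 2) * s : ℤ) : QuarticOrder c x e) * (y * y * y * y)
      + ((5 ^ (4 * j + 2) : ℤ) : QuarticOrder c x e) * (y * y * y * y * y), ?_, ?_⟩
    · refine dvd_add (dvd_add (dvd_add ?_ ?_) ?_) ?_ <;>
        exact five_dvd_mul (dvd_zero 5) (by assumption)
    · push_cast; ring
  obtain ⟨⟨z₀, z₁, z₂, z₃⟩, ⟨z, rfl : z₂ = 5 * z⟩, hz⟩ := key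
  rw [hu, hz, hy]
  rw [intCast_mul_mk, intCast_mul_mk, mk_add (s ^ 4 * 0), intCast_mul_mk, intCast_def (s ^ 5),
    mk_add]
  have h4 : ((s ^ 5 + 5 ^ (j + 2) * (s ^ 4 * 0 + 5 * z₀) : ℤ) : ZMod 5) = s ^ 5 := by
    push_cast [pow_succ, h5]; ring
  refine ⟨?_, s ^ 4 * w₁ + 5 * z₁, s ^ 4 * w₂ + 5 * z, s ^ 4 * w₃ + 5 * z₃, ?_, ?_, ?_, ?_, ?_, ?_⟩
  · rw [h4]; exact pow_ne_zero _ h0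
  · ring
  · ring
  · ring
  all_goals rw [h4]; push_cast [h1, h2, h3, h5]; ring

theorem nearInt_one_of_dvd {u : QuarticOrder c x e} (v₀ v₁ v₂ : ℤ)
    (h : ¬ 5 ∣ u.a₀ ∧ 25 ∣ u.a₁ - 5 * (u.a₀ * v₀) ∧ 125 ∣ u.a₂ - 25 * (u.a₀ * v₁) ∧
      25 ∣ u.a₃ - 5 * (u.a₀ * v₂)) :
    NearInt u 1 ![(v₀ : ZMod 5), v₁, v₂] := by
  obtain ⟨h0, ⟨w₁, h1⟩, ⟨w₂, h2⟩, w₃, h3⟩ := h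
  have h5 := five_eq_zero
  refine ⟨fun h => h0 ((ZMod.intCast_zmod_eq_zero_iff_dvd _ 5).1 h), u.a₀ * v₀ + 5 * w₁,
    u.a₀ * v₁ + 5 * w₂, u.a₀ * v₂ + 5 * w₃, by linear_combination h1,
    by linear_combination h2, by linear_combination h3, ?_, ?_, ?_⟩ <;>
  · push_cast [h5]; simp

theorem NearInt.pow_five_pow {u : QuarticOrder c x e} {j : ℕ} {v : Fin 3 → ZMod 5} (hj : j ≠ 0)
    (h : NearInt u j v) (n : ℕ) : NearInt (u ^ 5 ^ n) (j + n) v := by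
  induction n with
  | zero => simpa using h
  | succ n ih => rw [pow_succ, pow_mul]; exact ih.pow_five (by omega : j + n ≠ 0)

/-- The fifth power of a linear form `p - qξ` is close to an integer. -/
theorem nearInt_linear_pow_five {p q : ℤ} (hp : ¬ 5 ∣ p) (k : ℕ) {r : ZMod 5} {q' : ℤ}
    (hq : q = 5 ^ k * q') (hr : (q' : ZMod 5) = p * r) {t : ZMod 5} (ht : (q : ZMod 5) = p * t) :
    NearInt ((⟨p, -q, 0, 0⟩ : QuarticOrder c x e) ^ 5) (k + 1) ![-r, r * t, 0] := by
  have h5 := five_eq_zero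
  have hp0 : (p : ZMod 5) ≠ 0 := fun h => hp ((ZMod.intCast_zmod_eq_zero_iff_dvd _ 5).1 h)
  have hpow : (⟨p, -q, 0, 0⟩ : QuarticOrder c x e) ^ 5 =
      ⟨p ^ 5 + 1125 * (e * p * q ^ 4), -5 * p ^ 4 * q - 4500 * (x * p * q ^ 4)
        - 225 * (e * q ^ 5), 150 * p ^ 3 * q ^ 2 + 2250 * (c * p * q ^ 4) + 13500 * (x * q ^ 5),
        -150 * p ^ 2 * q ^ 3 - 450 * (c * q ^ 5)⟩ := by
    rw [pow_succ, pow_succ, pow_succ, pow_succ, pow_one]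
    simp only [mk_mul, mk.injEq]
    refine ⟨?_, ?_, ?_, ?_⟩ <;> ring
  rw [hpow]
  have h0 : ((p ^ 5 + 1125 * (e * p * q ^ 4) : ℤ) : ZMod 5) = p ^ 5 := by
    push_cast [show (1125 : ZMod 5) = 0 by decide]; ring
  refine ⟨?_, -p ^ 4 * q' - 900 * (x * p * q' * q ^ 3) - 45 * (e * q' * q ^ 4),
    6 * p ^ 3 * q' * q + 90 * (c * p * q' * q ^ 3) + 540 * (x * q' * q ^ 4),
    -30 * p ^ 2 * q' * q ^ 2 - 90 * (c * q' * q ^ 4), ?_, ?_, ?_, ?_, ?_, ?_⟩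
  · rw [h0]; exact pow_ne_zero _ hp0
  · subst hq; ring
  · subst hq; ring
  · subst hq; ring
  · rw [h0]
    push_cast [hr, show (900 : ZMod 5) = 0 by decide, show (45 : ZMod 5) = 0 by decide]
    ring
  · rw [h0]
    push_cast [hr, ht, show (90 : ZMod 5) = 0 by decide, show (540 : ZMod 5) = 0 by decide,
      show (6 : ZMod 5) = 1 by decide]
    ring
  · rw [h0]
    push_cast [show (90 : ZMod 5) = 0 by decide, show (30 : ZMod 5) = 0 by decide]
    ring

/-- A multiplicative relation between elements of level one gives a linear relation. -/
theorem NearInt.linear_relation {U W Z : QuarticOrder c x e} {j : ℕ} (hj : j ≠ 0)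
    {l E H : Fin 3 → ZMod 5} (hU : NearInt U j l) (hW : NearInt W j E) (hZ : NearInt Z j H)
    {a b d : ℤ}
    (h : U ^ a.toNat * W ^ b.toNat * Z ^ d.toNat =
      U ^ (-a).toNat * W ^ (-b).toNat * Z ^ (-d).toNat) :
    (a : ZMod 5) • l + (b : ZMod 5) • E + (d : ZMod 5) • H = 0 := by
  have h1 := ((hU.pow hj a.toNat).mul hj (hW.pow hj b.toNat)).mul hj (hZ.pow hj d.toNat)
  have h2 := ((hU.pow hj (-a).toNat).mul hj (hW.pow hj (-b).toNat)).mul hj (hZ.pow hj (-d).toNat)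
  rw [h] at h1
  have h3 := h1.unique h2
  have cast : ∀ n : ℤ, (n : ZMod 5) = (n.toNat : ZMod 5) - ((-n).toNat : ZMod 5) := fun n => by
    conv_lhs => rw [← Int.toNat_sub_toNat_neg n, Int.cast_sub, Int.cast_natCast, Int.cast_natCast]
  funext i
  have h4 := congrFun h3 i
  simp only [Pi.add_apply, Pi.smul_apply] at h4
  simp only [nsmul_eq_mul] at h4
  simp only [Pi.add_apply, Pi.smul_apply, smul_eq_mul, Pi.zero_apply, cast a, cast b, cast d]
  linear_combination h4

theorem toNat_five_pow_mul (n : ℕ) (b : ℤ) : (5 ^ n * b).toNat = 5 ^ n * b.toNat := by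
  rcases le_total 0 b with hb | hb
  · lift b to ℕ using hb
    exact_mod_cast rfl
  · rw [Int.toNat_of_nonpos hb, Int.toNat_of_nonpos (by
      exact mul_nonpos_of_nonneg_of_nonpos (by positivity) hb)]
    simp

/-- The argument of Skolem: elements with independent leading vectors satisfy no multiplicative
relation whose exponents are not all divisible by `5`. -/
theorem NearInt.five_dvd_of_relation {U W Z : QuarticOrder c x e} {k : ℕ}
    {l E H : Fin 3 → ZMod 5} (hU : NearInt U (k + 1) l) (hW : NearInt W 1 E) (hZ : NearInt Z 1 H)
    (hind : ∀ a b d : ZMod 5, a • l + b • E + d • H = 0 → a = 0 ∧ b = 0 ∧ d = 0) {a b d : ℤ}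
    (h : U ^ a.toNat * W ^ b.toNat * Z ^ d.toNat =
      U ^ (-a).toNat * W ^ (-b).toNat * Z ^ (-d).toNat) :
    (5 : ℤ) ∣ a ∧ (5 : ℤ) ∣ b ∧ (5 : ℤ) ∣ d := by
  have cast : ∀ n : ℤ, (n : ZMod 5) = 0 ↔ (5 : ℤ) ∣ n := fun n =>
    ZMod.intCast_zmod_eq_zero_iff_dvd n 5
  by_cases hbd : b = 0 ∧ d = 0
  · obtain ⟨rfl, rfl⟩ := hbd
    have h1 := NearInt.linear_relation (a := a) (b := 0) (d := 0) k.succ_ne_zero hU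
      (nearInt_one _) (nearInt_one _) (by simpa using h)
    obtain ⟨ha, -⟩ := hind a 0 0 (by simpa using h1)
    exact ⟨(cast a).1 ha, dvd_zero _, dvd_zero _⟩
  obtain ⟨v, b', d', rfl, rfl, hv⟩ : ∃ (v : ℕ) (b' d' : ℤ), b = 5 ^ v * b' ∧ d = 5 ^ v * d' ∧
      ¬ ((5 : ℤ) ∣ b' ∧ (5 : ℤ) ∣ d') := by
    have hg : Int.gcd b d ≠ 0 := by rwa [Ne, Int.gcd_eq_zero_iff]
    obtain ⟨v, g, hg5, hg'⟩ := Nat.exists_eq_pow_mul_and_not_dvd hg 5 (by norm_num)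
    have hvb : ((5 : ℤ) ^ v) ∣ b :=
      (by rw [hg']; push_cast; exact dvd_mul_right _ _ : ((5 : ℤ) ^ v) ∣ (Int.gcd b d : ℤ)).trans
        (Int.gcd_dvd_left ..)
    have hvd : ((5 : ℤ) ^ v) ∣ d :=
      (by rw [hg']; push_cast; exact dvd_mul_right _ _ : ((5 : ℤ) ^ v) ∣ (Int.gcd b d : ℤ)).trans
        (Int.gcd_dvd_right ..)
    obtain ⟨b', rfl⟩ := hvb
    obtain ⟨d', rfl⟩ := hvd
    refine ⟨v, b', d', rfl, rfl, fun ⟨h1, h2⟩ => hg5 ?_⟩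
    have h3 := Int.dvd_coe_gcd (mul_dvd_mul_left (5 ^ v) h1) (mul_dvd_mul_left (5 ^ v) h2)
    rw [hg'] at h3
    push_cast at h3
    exact_mod_cast Int.dvd_of_mul_dvd_mul_left (by positivity) h3
  have hrel : U ^ a.toNat * (W ^ 5 ^ v) ^ b'.toNat * (Z ^ 5 ^ v) ^ d'.toNat =
      U ^ (-a).toNat * (W ^ 5 ^ v) ^ (-b').toNat * (Z ^ 5 ^ v) ^ (-d').toNat := by
    simp only [← mul_neg, toNat_five_pow_mul, pow_mul] at h
    exact h
  have hW' := hW.pow_five_pow one_ne_zero v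
  have hZ' := hZ.pow_five_pow one_ne_zero v
  rcases lt_trichotomy (1 + v) (k + 1) with hlt | heq | hgt
  · have h1 := NearInt.linear_relation (by omega) (hU.of_lt hlt) hW' hZ' hrel
    obtain ⟨-, hb, hd⟩ := hind 0 b' d' (by simpa using h1)
    exact (hv ⟨(cast _).1 hb, (cast _).1 hd⟩).elim
  · rw [← heq] at hU
    have h1 := NearInt.linear_relation (by omega) hU hW' hZ' hrel
    obtain ⟨-, hb, hd⟩ := hind a b' d' h1
    exact (hv ⟨(cast _).1 hb, (cast _).1 hd⟩).elim
  · have h1 := NearInt.linear_relation (by omega) hU (hW'.of_lt hgt) (hZ'.of_lt hgt) hrel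
    obtain ⟨ha, -⟩ := hind a 0 0 (by simpa using h1)
    have hv0 : (5 : ℤ) ∣ 5 ^ v := dvd_pow_self 5 (by omega)
    exact ⟨(cast _).1 ha, hv0.mul_right _, hv0.mul_right _⟩

end QuarticOrder

theorem exists_five_pow_mul {g : Fin 3 → ℤ} (hg : g ≠ 0) :
    ∃ (v : ℕ) (g' : Fin 3 → ℤ), g = (5 : ℤ) ^ v • g' ∧ ¬ ∀ i, (5 : ℤ) ∣ g' i := by
  have hgcd : Finset.univ.gcd (fun i => (g i).natAbs) ≠ 0 := fun h => hg <| funext fun i =>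
    Int.natAbs_eq_zero.1 (Finset.gcd_eq_zero_iff.1 h i (Finset.mem_univ i))
  obtain ⟨v, m, hm, hv⟩ := Nat.exists_eq_pow_mul_and_not_dvd hgcd 5 (by norm_num)
  have hdvd : ∀ i, (5 : ℤ) ^ v ∣ g i := fun i => by
    rw [← Int.natAbs_dvd_natAbs, Int.natAbs_pow]
    exact (Dvd.intro _ hv.symm).trans (Finset.gcd_dvd (Finset.mem_univ i))
  choose g' hg' using hdvd
  refine ⟨v, g', funext hg', fun h => hm ?_⟩
  have h5 : 5 ^ v * 5 ∣ 5 ^ v * m := by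
    rw [← hv]
    refine Finset.dvd_gcd fun i _ => ?_
    rw [hg' i, Int.natAbs_mul, Int.natAbs_pow]
    exact mul_dvd_mul_left _ (Int.natAbs_dvd_natAbs.2 (h i))
  exact Nat.dvd_of_mul_dvd_mul_left (by positivity) h5

open NumberField in
/-- Three units of a number field of unit rank at most `2` with a real embedding. -/
theorem exists_unit_relation {K : Type*} [Field K] [NumberField K] (σ : K →+* ℝ)
    (hrank : Units.rank K ≤ 2) (u : Fin 3 → (𝓞 K)ˣ) :
    ∃ g : Fin 3 → ℤ, (¬ ∀ i, (5 : ℤ) ∣ g i) ∧ (∏ i, u i ^ g i) ^ 2 = 1 := by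
  have hdep : ¬ LinearIndependent ℤ (fun i => Additive.ofMul (u i)) := fun h => by
    have h1 := h.fintype_card_le_finrank
    rw [Units.finrank_eq, Fintype.card_fin] at h1
    omega
  obtain ⟨g, hg, i, hi⟩ := Fintype.not_linearIndependent_iff.1 hdep
  have hgt : ∏ i, u i ^ g i = 1 := hg
  obtain ⟨v, g', rfl, hg'⟩ := exists_five_pow_mul (g := g) (fun h => hi (by simp [h]))
  refine ⟨g', hg', ?_⟩
  set w := ∏ i, u i ^ g' i with hw
  have hwt : w ∈ Units.torsion K := by
    have h1 : ∏ i, u i ^ ((5 : ℤ) ^ v • g') i = w ^ 5 ^ v := by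
      rw [hw, ← Finset.prod_pow]
      refine Finset.prod_congr rfl fun i _ => ?_
      rw [Pi.smul_apply, smul_eq_mul, mul_comm, zpow_mul]
      exact_mod_cast rfl
    rw [Units.torsion, CommGroup.mem_torsion]
    exact isOfFinOrder_iff_pow_eq_one.2 ⟨5 ^ v, by positivity, h1.symm.trans hgt⟩
  have h1 := (Units.mem_torsion K).1 hwt (InfinitePlace.mk (Complex.ofRealHom.comp σ))
  rw [InfinitePlace.apply] at h1
  have h2 : |σ ((w : 𝓞 K) : K)| = 1 := by simpa using h1
  have h3 : σ (((w : 𝓞 K) : K) ^ 2) = σ 1 := by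
    rw [map_pow, map_one, ← sq_abs, h2, one_pow]
  have h4 := σ.injective h3
  ext
  simpa using h4

open Polynomial

theorem coeff_eq_of_quartic {R : Type*} [CommRing R] {a b c d b' c' d' : R}
    (h : (X : R[X]) ^ 4 + C a * X ^ 3 + C b * X ^ 2 + C c * X + C d =
      X ^ 4 + C b' * X ^ 2 + C c' * X + C d') : a = 0 ∧ b = b' ∧ c = c' ∧ d = d' := by
  have k3 := congrArg (coeff · 3) h
  have k2 := congrArg (coeff · 2) h
  have k1 := congrArg (coeff · 1) h
  have k0 := congrArg (coeff · 0) h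
  simp [coeff_X, coeff_C, coeff_X_pow] at k3 k2 k1 k0
  exact ⟨k3, k2, k1, k0⟩

namespace QuarticOrder

variable {c x e : ℤ}

/-- The minimal polynomial of `ξ`. -/
noncomputable def poly (c x e : ℤ) : ℤ[X] :=
  X ^ 4 + C (-30 * c) * X ^ 2 + C (900 * x) * X + C (-225 * e)

theorem poly_natDegree : (poly c x e).natDegree = 4 := by
  rw [poly]; compute_degree!

theorem poly_monic : (poly c x e).Monic := by
  rw [poly]; monicity!

/-- The ring homomorphism sending `ξ` to a given root. -/
def evalHom {L : Type*} [Field L] (h15 : (15 : L) ≠ 0) (θ : L)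
    (hθ : θ ^ 4 - 30 * c * θ ^ 2 + 900 * x * θ - 225 * e = 0) : QuarticOrder c x e →+* L where
  toFun u := u.a₀ + u.a₁ * θ + u.a₂ * (θ ^ 2 / 15) + u.a₃ * (θ ^ 3 / 15)
  map_one' := by simp [one_def]
  map_zero' := by simp [zero_def]
  map_add' u v := by
    cases u; cases v; simp only [mk_add]; push_cast; ring
  map_mul' u v := by
    cases u with | mk p q r s
    cases v with | mk p' q' r' s'
    simp only [mk_mul]
    push_cast
    field_simp
    linear_combination (-(r * r') - 15 * (q * s' + s * q') - θ * (r * s' + s * r')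
      - s * s' * (θ ^ 2 + 30 * c) : L) * hθ

theorem evalHom_apply {L : Type*} [Field L] (h15 : (15 : L) ≠ 0) (θ : L)
    (hθ : θ ^ 4 - 30 * c * θ ^ 2 + 900 * x * θ - 225 * e = 0) (u : QuarticOrder c x e) :
    evalHom h15 θ hθ u = u.a₀ + u.a₁ * θ + u.a₂ * (θ ^ 2 / 15) + u.a₃ * (θ ^ 3 / 15) := rfl

instance : Module.Finite ℤ (QuarticOrder c x e) := by
  classical
  refine ⟨⟨({1, ⟨0, 1, 0, 0⟩, ⟨0, 0, 1, 0⟩, ⟨0, 0, 0, 1⟩} :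
    Finset (QuarticOrder c x e)), ?_⟩⟩
  rw [eq_top_iff]
  rintro ⟨p, q, r, s⟩ -
  have h : (⟨p, q, r, s⟩ : QuarticOrder c x e) = p • (1 : QuarticOrder c x e) +
      q • (⟨0, 1, 0, 0⟩ : QuarticOrder c x e) + r • (⟨0, 0, 1, 0⟩ : QuarticOrder c x e) +
      s • (⟨0, 0, 0, 1⟩ : QuarticOrder c x e) := by
    simp only [zsmul_eq_mul, one_def, intCast_mul_mk, mk_add]; simp
  rw [h]
  refine add_mem (add_mem (add_mem ?_ ?_) ?_) ?_ <;>
  · refine Submodule.smul_mem _ _ (Submodule.subset_span ?_)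
    simp

/-- A monic quartic over a finite prime field without cubic term is irreducible if it has no root
and no factorization into quadratics. -/
theorem irreducible_of_mod {r : ℕ} [Fact r.Prime]
    (h1 : ∀ z : ZMod r, z ^ 4 - 30 * c * z ^ 2 + 900 * x * z - 225 * e ≠ 0)
    (h2 : ∀ s t : ZMod r, ¬ (s * (-30 * c - t + s ^ 2 - t) = 900 * x ∧
      t * (-30 * c - t + s ^ 2) = -225 * e)) : Irreducible (poly c x e) := by
  refine poly_monic.irreducible_of_irreducible_map (Int.castRingHom (ZMod r)) _ ?_
  have hm : ((poly c x e).map (Int.castRingHom (ZMod r))).Monic := poly_monic.map _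
  have hdeg : ((poly c x e).map (Int.castRingHom (ZMod r))).natDegree = 4 := by
    rw [poly_monic.natDegree_map, poly_natDegree]
  have heq : (poly c x e).map (Int.castRingHom (ZMod r)) =
      X ^ 4 + C (-30 * c : ZMod r) * X ^ 2 + C (900 * x : ZMod r) * X + C (-225 * e : ZMod r) := by
    simp only [poly, Polynomial.map_add, Polynomial.map_mul, Polynomial.map_pow, map_X, map_C,
      Int.coe_castRingHom, Int.cast_mul, Int.cast_neg, Int.cast_ofNat]
  rw [hm.irreducible_iff_natDegree']
  refine ⟨fun h => by rw [h] at hdeg; simp at hdeg, fun f g hf hg hfg hmem => ?_⟩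
  rw [hdeg, Finset.mem_Ioc] at hmem
  have hsum : f.natDegree + g.natDegree = 4 := by rw [← hf.natDegree_mul hg, hfg, hdeg]
  obtain hg1 | hg2 : g.natDegree = 1 ∨ g.natDegree = 2 := by omega
  · have hroot : (f * g).eval (-g.coeff 0) = 0 := by
      rw [eval_mul, hg.eq_X_add_C hg1]; simp
    rw [hfg, heq] at hroot
    refine h1 (-g.coeff 0) ?_
    simp at hroot
    linear_combination hroot
  · have hf2 : f.natDegree = 2 := by omega
    have quad : ∀ q : (ZMod r)[X], q.Monic → q.natDegree = 2 →
        q = X ^ 2 + C (q.coeff 1) * X + C (q.coeff 0) := fun q hq hq2 => by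
      conv_lhs => rw [q.as_sum_range_C_mul_X_pow, hq2]
      rw [Finset.sum_range_succ, Finset.sum_range_succ, Finset.sum_range_one]
      have : q.coeff 2 = 1 := by rw [← hq2]; exact hq
      rw [this]; simp; ring
    have hprod : (X ^ 2 + C (f.coeff 1) * X + C (f.coeff 0)) *
        (X ^ 2 + C (g.coeff 1) * X + C (g.coeff 0)) =
        X ^ 4 + C (-30 * c : ZMod r) * X ^ 2 + C (900 * x : ZMod r) * X +
          C (-225 * e : ZMod r) := by
      rw [← quad f hf hf2, ← quad g hg hg2, hfg, heq]
    have hprod' : X ^ 4 + C (f.coeff 1 + g.coeff 1) * X ^ 3 +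
        C (f.coeff 0 + g.coeff 0 + f.coeff 1 * g.coeff 1) * X ^ 2 +
        C (f.coeff 1 * g.coeff 0 + f.coeff 0 * g.coeff 1) * X + C (f.coeff 0 * g.coeff 0) =
        X ^ 4 + C (-30 * c : ZMod r) * X ^ 2 + C (900 * x : ZMod r) * X +
          C (-225 * e : ZMod r) := by
      rw [← hprod]; simp only [C_add, C_mul]; ring
    obtain ⟨k3, k2, k1, k0⟩ := coeff_eq_of_quartic hprod'
    have hg1 : g.coeff 1 = -f.coeff 1 := by linear_combination k3
    have hg0 : g.coeff 0 = -30 * c - f.coeff 0 + f.coeff 1 ^ 2 := by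
      linear_combination k2 - f.coeff 1 * hg1
    rw [hg0] at k0 k1
    rw [hg1] at k1
    exact h2 (f.coeff 1) (f.coeff 0) ⟨by linear_combination k1, k0⟩

end QuarticOrder

/-- A real quartic of negative discriminant has a root in the upper half plane. -/
theorem exists_root_im_pos {a₂ a₁ a₀ : ℝ}
    (h : 4 * (12 * a₀ + a₂ ^ 2) ^ 3 < (72 * a₂ * a₀ - 27 * a₁ ^ 2 - 2 * a₂ ^ 3) ^ 2) :
    ∃ z : ℂ, z ^ 4 + a₂ * z ^ 2 + a₁ * z + a₀ = 0 ∧ 0 < z.im := by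
  by_contra! hz
  set f : ℂ[X] := X ^ 4 + C (a₂ : ℂ) * X ^ 2 + C (a₁ : ℂ) * X + C (a₀ : ℂ) with hf
  have hm : f.Monic := by rw [hf]; monicity!
  have hd : f.natDegree = 4 := by rw [hf]; compute_degree!
  have hsp : f.Splits := IsAlgClosed.splits f
  have hcard : f.roots.card = 4 := by rw [← hd]; exact hsp.natDegree_eq_card_roots.symm
  have hreal : ∀ z ∈ f.roots, ((z.re : ℝ) : ℂ) = z := by
    intro z hzr
    have h0 : z ^ 4 + a₂ * z ^ 2 + a₁ * z + a₀ = 0 := by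
      have := (mem_roots'.1 hzr).2
      simpa [hf] using this
    have h1 := hz z h0
    have h2 := hz (starRingEnd ℂ z) (by
      have := congrArg (starRingEnd ℂ) h0
      simpa using this)
    rw [Complex.conj_im] at h2
    exact Complex.ext (by simp) (by simp; linarith)
  obtain ⟨r₁, r₂, r₃, r₄, hr⟩ : ∃ r₁ r₂ r₃ r₄, f.roots = {r₁, r₂, r₃, r₄} := by
    obtain ⟨r₁, s, hs⟩ := Multiset.card_pos_iff_exists_mem.1 (by omega : 0 < f.roots.card) |>.imp
      fun a ha => Multiset.exists_cons_of_mem ha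
    rw [hs, Multiset.card_cons] at hcard
    obtain ⟨r₂, r₃, r₄, rfl⟩ := Multiset.card_eq_three.1 (by omega : s.card = 3)
    exact ⟨r₁, r₂, r₃, r₄, hs⟩
  have hprod : f = (X - C r₁) * ((X - C r₂) * ((X - C r₃) * (X - C r₄))) := by
    have := hsp.eq_prod_roots_of_monic hm
    rw [hr] at this
    simpa using this
  have e1 := hreal r₁ (by simp [hr])
  have e2 := hreal r₂ (by simp [hr])
  have e3 := hreal r₃ (by simp [hr])
  have e4 := hreal r₄ (by simp [hr])
  generalize r₁.re = s₁ at e1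
  generalize r₂.re = s₂ at e2
  generalize r₃.re = s₃ at e3
  generalize r₄.re = s₄ at e4
  subst e1 e2 e3 e4
  have hcmp : (X : ℂ[X]) ^ 4 + C (-(s₁ + s₂ + s₃ + s₄) : ℂ) * X ^ 3 +
      C (s₁ * s₂ + s₁ * s₃ + s₁ * s₄ + s₂ * s₃ + s₂ * s₄ + s₃ * s₄ : ℂ) * X ^ 2 +
      C (-(s₁ * s₂ * s₃ + s₁ * s₂ * s₄ + s₁ * s₃ * s₄ + s₂ * s₃ * s₄) : ℂ) * X +
      C (s₁ * s₂ * s₃ * s₄ : ℂ) =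
      X ^ 4 + C (a₂ : ℂ) * X ^ 2 + C (a₁ : ℂ) * X + C (a₀ : ℂ) := by
    rw [← hf, hprod]
    simp only [C_add, C_mul, C_neg]
    ring
  obtain ⟨k3, k2, k1, k0⟩ := coeff_eq_of_quartic hcmp
  norm_cast at k3 k2 k1 k0
  have hs : s₄ = -(s₁ + s₂ + s₃) := by linarith
  subst hs
  have hdisc : 27 * ((s₁ - s₂) * (s₁ - s₃) * (s₁ + (s₁ + s₂ + s₃)) * (s₂ - s₃) *
      (s₂ + (s₁ + s₂ + s₃)) * (s₃ + (s₁ + s₂ + s₃))) ^ 2 =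
      4 * (12 * a₀ + a₂ ^ 2) ^ 3 - (72 * a₂ * a₀ - 27 * a₁ ^ 2 - 2 * a₂ ^ 3) ^ 2 := by
    rw [← k2, ← k1, ← k0]; ring
  nlinarith [sq_nonneg ((s₁ - s₂) * (s₁ - s₃) * (s₁ + (s₁ + s₂ + s₃)) * (s₂ - s₃) *
      (s₂ + (s₁ + s₂ + s₃)) * (s₃ + (s₁ + s₂ + s₃)))]

open NumberField in
theorem unit_rank_le_two {K : Type*} [Field K] [NumberField K] (hK : Module.finrank ℚ K = 4)
    (φ : K →+* ℂ) {a : K} (ha : (φ a).im ≠ 0) : Units.rank K ≤ 2 := by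
  have h1 := InfinitePlace.card_add_two_mul_card_eq_rank K
  have h2 := InfinitePlace.card_eq_nrRealPlaces_add_nrComplexPlaces K
  have h3 : 0 < InfinitePlace.nrComplexPlaces K := by
    classical
    refine Fintype.card_pos_iff.2 ⟨InfinitePlace.mk φ, ?_⟩
    rw [InfinitePlace.isComplex_mk_iff]
    intro hr
    refine ha (Complex.conj_eq_iff_im.1 ?_)
    exact DFunLike.congr_fun (ComplexEmbedding.isReal_iff.1 hr) a
  rw [Units.rank]
  omega

namespace QuarticOrder

variable {c x e : ℤ}

open NumberField in
/-- The unit theorem of Dirichlet for `QuarticOrder c x e`. -/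
theorem exists_unit_relation (hirr : Irreducible (poly c x e))
    (hneg : ∃ n : ℤ, n ^ 4 - 30 * c * n ^ 2 + 900 * x * n - 225 * e < 0)
    (hdisc : 4 * (12 * (-225 * e) + (-30 * c) ^ 2) ^ 3 <
      (72 * (-30 * c) * (-225 * e) - 27 * (900 * x) ^ 2 - 2 * (-30 * c) ^ 3) ^ 2)
    (u : Fin 3 → (QuarticOrder c x e)ˣ) :
    ∃ g : Fin 3 → ℤ, (¬ ∀ i, (5 : ℤ) ∣ g i) ∧ (∏ i, u i ^ g i) ^ 2 = 1 := by
  set f : ℚ[X] := (poly c x e).map (Int.castRingHom ℚ) with hf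
  have hfirr : Irreducible f := poly_monic.irreducible_iff_irreducible_map_fraction_map.1 hirr
  have hfm : f.Monic := poly_monic.map _
  have hfd : f.natDegree = 4 := by rw [hf, poly_monic.natDegree_map, poly_natDegree]
  have hfe : ∀ {L : Type} [Field L] [CharZero L] (i : ℚ →+* L) (θ : L),
      f.eval₂ i θ = θ ^ 4 - 30 * c * θ ^ 2 + 900 * x * θ - 225 * e := fun i θ => by
    rw [hf, eval₂_map, Subsingleton.elim (i.comp _) (Int.castRingHom _), poly]
    simp only [eval₂_add, eval₂_mul, eval₂_pow, eval₂_X, eval₂_C, Int.coe_castRingHom, Int.cast_mul,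
      Int.cast_neg, Int.cast_ofNat]
    ring
  have : Fact (Irreducible f) := ⟨hfirr⟩
  set K := AdjoinRoot f
  have : NumberField K :=
    { to_finiteDimensional := hfm.finite_adjoinRoot }
  have hfin : Module.finrank ℚ K = 4 := by
    rw [← hfd]; exact (AdjoinRoot.powerBasis hfirr.ne_zero).finrank
  obtain ⟨z, hz, him⟩ := exists_root_im_pos (a₂ := -30 * c) (a₁ := 900 * x) (a₀ := -225 * e)
    (by exact_mod_cast hdisc)
  have hz' : f.eval₂ (algebraMap ℚ ℂ) z = 0 := by
    rw [hfe, ← hz]; push_cast; ring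
  have hrank : Units.rank K ≤ 2 := by
    refine unit_rank_le_two hfin (AdjoinRoot.lift (algebraMap ℚ ℂ) z hz')
      (a := AdjoinRoot.root f) ?_
    rw [AdjoinRoot.lift_root]
    exact him.ne'
  obtain ⟨y, hy⟩ : ∃ y : ℝ, f.eval₂ (algebraMap ℚ ℝ) y = 0 := by
    obtain ⟨n, hn⟩ := hneg
    have htop : Filter.Tendsto (fun y : ℝ => (f.map (algebraMap ℚ ℝ)).eval y)
        Filter.atTop Filter.atTop := by
      refine tendsto_atTop_of_leadingCoeff_nonneg _ ?_ ?_
      · rw [degree_map, degree_eq_natDegree hfm.ne_zero, hfd]; norm_num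
      · rw [(hfm.map _).leadingCoeff]; norm_num
    obtain ⟨m, hm, hnm⟩ :=
      ((htop.eventually_ge_atTop 0).and (Filter.eventually_ge_atTop (n : ℝ))).exists
    have hn' : (f.map (algebraMap ℚ ℝ)).eval (n : ℝ) ≤ 0 := by
      rw [eval_map, hfe]
      exact_mod_cast hn.le
    obtain ⟨y, -, hy⟩ := intermediate_value_Icc hnm
      (f.map (algebraMap ℚ ℝ)).continuous.continuousOn ⟨hn', hm⟩
    exact ⟨y, by rwa [← eval_map]⟩
  have hθ := AdjoinRoot.eval₂_root f
  rw [hfe] at hθ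
  have h15 : (15 : K) ≠ 0 := by norm_num
  set φ := evalHom h15 _ hθ with hφ
  have hinj : Function.Injective φ := by
    rw [injective_iff_map_eq_zero]
    rintro ⟨p, q, r, s⟩ h
    rw [hφ, evalHom_apply] at h
    have h1 : AdjoinRoot.mk f (C (p : ℚ) + C (q : ℚ) * X + C (r / 15 : ℚ) * X ^ 2 +
        C (s / 15 : ℚ) * X ^ 3) = 0 := by
      rw [← h]
      simp
      ring
    have h2 := eq_zero_of_dvd_of_natDegree_lt (AdjoinRoot.mk_eq_zero.1 h1)
      (lt_of_le_of_lt (by compute_degree) (by rw [hfd]; norm_num : 3 < f.natDegree))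
    obtain ⟨k3, k2, k1, k0⟩ := coeff_eq_of_quartic (a := (s / 15 : ℚ)) (b := (r / 15 : ℚ))
      (c := (q : ℚ)) (d := (p : ℚ)) (b' := 0) (c' := 0) (d' := 0) (by
        rw [C_0]; linear_combination h2)
    ext
    · exact_mod_cast k0
    · exact_mod_cast k1
    · exact_mod_cast (div_eq_zero_iff.1 k2).resolve_right (by norm_num)
    · exact_mod_cast (div_eq_zero_iff.1 k3).resolve_right (by norm_num)
  have hint : ∀ v, IsIntegral ℤ (φ v) := fun v => map_isIntegral_int φ (IsIntegral.of_finite ℤ v)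
  set ψ : QuarticOrder c x e →* 𝓞 K := RingOfIntegers.restrict_monoidHom φ.toMonoidHom hint
  obtain ⟨g, hg, h⟩ := _root_.exists_unit_relation
    (AdjoinRoot.lift (algebraMap ℚ ℝ) y hy) hrank (fun i => Units.map ψ (u i))
  refine ⟨g, hg, Units.map_injective (f := ψ) (fun a b hab => hinj ?_) ?_⟩
  · exact congrArg (algebraMap (𝓞 K) K) hab
  · rw [map_one, ← h]; simp

/-- The unit `p - qξ` attached to a representation of `1` by the norm form. -/
def linearUnit (p q : ℤ)
    (h : p ^ 4 - 30 * c * p ^ 2 * q ^ 2 + 900 * x * p * q ^ 3 - 225 * e * q ^ 4 = 1) :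
    (QuarticOrder c x e)ˣ :=
  Units.mkOfMulEqOne ⟨p, -q, 0, 0⟩
    ⟨p ^ 3 - 30 * c * p * q ^ 2 + 900 * x * q ^ 3, p ^ 2 * q - 30 * c * q ^ 3, 15 * p * q ^ 2,
      15 * q ^ 3⟩ (by
    simp only [mk_mul, one_def, mk.injEq]
    refine ⟨by linear_combination h, ?_, ?_, ?_⟩ <;> ring)

theorem coe_linearUnit (p q : ℤ)
    (h : p ^ 4 - 30 * c * p ^ 2 * q ^ 2 + 900 * x * p * q ^ 3 - 225 * e * q ^ 4 = 1) :
    (linearUnit p q h : QuarticOrder c x e) = ⟨p, -q, 0, 0⟩ := rfl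

theorem not_five_dvd_of_norm {p q : ℤ}
    (h : p ^ 4 - 30 * c * p ^ 2 * q ^ 2 + 900 * x * p * q ^ 3 - 225 * e * q ^ 4 = 1) :
    ¬ (5 : ℤ) ∣ p := by
  rintro ⟨p, rfl⟩
  have : (5 : ℤ) ∣ 1 := ⟨125 * p ^ 4 - 150 * c * p ^ 2 * q ^ 2 + 900 * x * p * q ^ 3
    - 45 * e * q ^ 4, by linear_combination -h⟩
  omega

theorem nearInt_linear_pow {p q q' : ℤ} (hp : ¬ (5 : ℤ) ∣ p) (k : ℕ) (hq : q = 5 ^ k * q') :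
    NearInt ((⟨p, -q, 0, 0⟩ : QuarticOrder c x e) ^ 120) (k + 1)
      ![(q' / (p * p) : ZMod 5) * p, -((q' / (p * p) : ZMod 5) * q), 0] := by
  have hp0 : (p : ZMod 5) ≠ 0 := fun h => hp ((ZMod.intCast_zmod_eq_zero_iff_dvd _ 5).1 h)
  have h := (nearInt_linear_pow_five (c := c) (x := x) (e := e) hp k (r := q' / p)
    (t := (q : ZMod 5) / p) hq (by field_simp) (by field_simp)).pow k.succ_ne_zero 24
  rw [← pow_mul] at h
  convert h using 1
  rw [← Nat.cast_smul_eq_nsmul (ZMod 5), show ((24 : ℕ) : ZMod 5) = -1 by decide]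
  ext i
  fin_cases i <;> simp <;> field_simp

theorem exists_nearInt_linear_pow {p q : ℤ} (hp : ¬ (5 : ℤ) ∣ p) (hq : q ≠ 0) :
    ∃ (k : ℕ) (r : ZMod 5), r ≠ 0 ∧
      NearInt ((⟨p, -q, 0, 0⟩ : QuarticOrder c x e) ^ 120) (k + 1) ![r * p, -(r * q), 0] := by
  have hp0 : (p : ZMod 5) ≠ 0 := fun h => hp ((ZMod.intCast_zmod_eq_zero_iff_dvd _ 5).1 h)
  obtain ⟨k, q', hq', rfl⟩ : ∃ (k : ℕ) (q' : ℤ), ¬ (5 : ℤ) ∣ q' ∧ q = 5 ^ k * q' := by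
    have hf : FiniteMultiplicity 5 q := Int.finiteMultiplicity_iff.2 ⟨by norm_num, hq⟩
    obtain ⟨q', h1, h2⟩ := hf.exists_eq_pow_mul_and_not_dvd
    exact ⟨_, q', h2, h1⟩
  have hq0 : (q' : ZMod 5) ≠ 0 := fun h => hq' ((ZMod.intCast_zmod_eq_zero_iff_dvd _ 5).1 h)
  exact ⟨k, _, div_ne_zero hq0 (mul_ne_zero hp0 hp0), nearInt_linear_pow hp k rfl⟩

/-- Exponents in a relation between units, separated by sign. -/
theorem relation_of_units {R : Type*} [CommRing R] (u : Fin 3 → Rˣ) (g : Fin 3 → ℤ)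
    (h : (∏ i, u i ^ g i) ^ 2 = 1) :
    ((u 0 : R) ^ 120) ^ (g 0).toNat * ((u 1 : R) ^ 120) ^ (g 1).toNat *
        ((u 2 : R) ^ 120) ^ (g 2).toNat =
      ((u 0 : R) ^ 120) ^ (-g 0).toNat * ((u 1 : R) ^ 120) ^ (-g 1).toNat *
        ((u 2 : R) ^ 120) ^ (-g 2).toNat := by
  have key : ∀ (w : Rˣ) (n : ℤ), (w ^ 120) ^ n.toNat = (w ^ n) ^ 120 * (w ^ 120) ^ (-n).toNat := by
    intro w n
    rw [← zpow_natCast, ← zpow_natCast (w ^ 120), ← zpow_natCast, ← zpow_natCast (w ^ n),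
      ← zpow_mul, ← zpow_mul, ← zpow_mul, ← zpow_add]
    congr 1
    have := Int.toNat_sub_toNat_neg n
    push_cast
    linear_combination 120 * this
  have h1 : (u 0 ^ g 0) ^ 120 * (u 1 ^ g 1) ^ 120 * (u 2 ^ g 2) ^ 120 = 1 := by
    rw [← mul_pow, ← mul_pow, ← Fin.prod_univ_three (fun i => u i ^ g i),
      show (120 : ℕ) = 2 * 60 by norm_num, pow_mul, h, one_pow]
  have h2 : (u 0 ^ 120) ^ (g 0).toNat * (u 1 ^ 120) ^ (g 1).toNat * (u 2 ^ 120) ^ (g 2).toNat =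
      (u 0 ^ 120) ^ (-g 0).toNat * (u 1 ^ 120) ^ (-g 1).toNat * (u 2 ^ 120) ^ (-g 2).toNat := by
    rw [key (u 0), key (u 1), key (u 2)]
    calc _ = (u 0 ^ g 0) ^ 120 * (u 1 ^ g 1) ^ 120 * (u 2 ^ g 2) ^ 120 *
        ((u 0 ^ 120) ^ (-g 0).toNat * (u 1 ^ 120) ^ (-g 1).toNat *
          (u 2 ^ 120) ^ (-g 2).toNat) := by
          simp only [mul_assoc, mul_left_comm]
      _ = _ := by rw [h1, one_mul]
  exact_mod_cast congrArg Units.val h2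

theorem independent_of_cross {l E H : Fin 3 → ZMod 5}
    (h : (E 1 * H 2 - E 2 * H 1) * l 0 + (E 2 * H 0 - E 0 * H 2) * l 1 +
      (E 0 * H 1 - E 1 * H 0) * l 2 ≠ 0) (a b d : ZMod 5)
    (h0 : a • l + b • E + d • H = 0) : a = 0 ∧ b = 0 ∧ d = 0 := by
  have k0 := congrFun h0 0
  have k1 := congrFun h0 1
  have k2 := congrFun h0 2
  simp only [Pi.add_apply, Pi.smul_apply, smul_eq_mul, Pi.zero_apply] at k0 k1 k2
  refine ⟨?_, ?_, ?_⟩ <;> refine (mul_eq_zero.1 ?_).resolve_right h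
  · linear_combination (E 1 * H 2 - E 2 * H 1) * k0 + (E 2 * H 0 - E 0 * H 2) * k1 +
      (E 0 * H 1 - E 1 * H 0) * k2
  · linear_combination (H 1 * l 2 - H 2 * l 1) * k0 + (H 2 * l 0 - H 0 * l 2) * k1 +
      (H 0 * l 1 - H 1 * l 0) * k2
  · linear_combination (l 1 * E 2 - l 2 * E 1) * k0 + (l 2 * E 0 - l 0 * E 2) * k1 +
      (l 0 * E 1 - l 1 * E 0) * k2

theorem false_of_independent (hirr : Irreducible (poly c x e))
    (hneg : ∃ n : ℤ, n ^ 4 - 30 * c * n ^ 2 + 900 * x * n - 225 * e < 0)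
    (hdisc : 4 * (12 * (-225 * e) + (-30 * c) ^ 2) ^ 3 <
      (72 * (-30 * c) * (-225 * e) - 27 * (900 * x) ^ 2 - 2 * (-30 * c) ^ 3) ^ 2)
    {u w z : (QuarticOrder c x e)ˣ} {k : ℕ} {l E H : Fin 3 → ZMod 5}
    (hu : NearInt ((u : QuarticOrder c x e) ^ 120) (k + 1) l)
    (hw : NearInt ((w : QuarticOrder c x e) ^ 120) 1 E)
    (hz : NearInt ((z : QuarticOrder c x e) ^ 120) 1 H)
    (h : (E 1 * H 2 - E 2 * H 1) * l 0 + (E 2 * H 0 - E 0 * H 2) * l 1 +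
      (E 0 * H 1 - E 1 * H 0) * l 2 ≠ 0) : False := by
  obtain ⟨g, hg, hrel⟩ := exists_unit_relation hirr hneg hdisc ![u, w, z]
  have hrel' := relation_of_units _ g hrel
  simp only [Matrix.cons_val] at hrel'
  obtain ⟨h0, h1, h2⟩ := hu.five_dvd_of_relation hw hz (independent_of_cross h) hrel'
  refine hg fun i => ?_
  fin_cases i <;> assumption

theorem eq_zero_of_norm_eq_one (hirr : Irreducible (poly c x e))
    (hneg : ∃ n : ℤ, n ^ 4 - 30 * c * n ^ 2 + 900 * x * n - 225 * e < 0)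
    (hdisc : 4 * (12 * (-225 * e) + (-30 * c) ^ 2) ^ 3 <
      (72 * (-30 * c) * (-225 * e) - 27 * (900 * x) ^ 2 - 2 * (-30 * c) ^ 3) ^ 2)
    {w z : (QuarticOrder c x e)ˣ} {E₀ E₁ E₂ H₀ H₁ H₂ : ℤ}
    (hw : NearInt ((w : QuarticOrder c x e) ^ 120) 1 ![(E₀ : ZMod 5), E₁, E₂])
    (hz : NearInt ((z : QuarticOrder c x e) ^ 120) 1 ![(H₀ : ZMod 5), H₁, H₂]) {p q : ℤ}
    (h : p ^ 4 - 30 * c * p ^ 2 * q ^ 2 + 900 * x * p * q ^ 3 - 225 * e * q ^ 4 = 1)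
    (hpq : ¬ (5 : ℤ) ∣ (E₁ * H₂ - E₂ * H₁) * p - (E₂ * H₀ - E₀ * H₂) * q) : q = 0 := by
  by_contra hq
  obtain ⟨k, r, hr, hu⟩ := exists_nearInt_linear_pow (c := c) (x := x) (e := e)
    (not_five_dvd_of_norm h) hq
  rw [← coe_linearUnit p q h] at hu
  refine false_of_independent hirr hneg hdisc hu hw hz fun h0 => hpq ?_
  refine (ZMod.intCast_zmod_eq_zero_iff_dvd _ 5).1 ((mul_eq_zero.1 ?_).resolve_left hr)
  simp at h0
  push_cast
  linear_combination h0

/-- Two units of the order attached to an irreducible quartic with two real roots, together with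
the first-order `5`-adic expansions of their `120`-th powers. -/
structure UnitPair (c x e : ℤ) where
  irreducible : Irreducible (poly c x e)
  exists_neg : ∃ n : ℤ, n ^ 4 - 30 * c * n ^ 2 + 900 * x * n - 225 * e < 0
  disc : 4 * (12 * (-225 * e) + (-30 * c) ^ 2) ^ 3 <
    (72 * (-30 * c) * (-225 * e) - 27 * (900 * x) ^ 2 - 2 * (-30 * c) ^ 3) ^ 2
  /-- The first unit. -/
  w : (QuarticOrder c x e)ˣ
  /-- The second unit. -/
  z : (QuarticOrder c x e)ˣ
  /-- The expansion of the first unit. -/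
  E : Fin 3 → ℤ
  /-- The expansion of the second unit. -/
  H : Fin 3 → ℤ
  nearInt_w : NearInt ((w : QuarticOrder c x e) ^ 120) 1 ![(E 0 : ZMod 5), E 1, E 2]
  nearInt_z : NearInt ((z : QuarticOrder c x e) ^ 120) 1 ![(H 0 : ZMod 5), H 1, H 2]

/-- The value at `(p, q)` of the quartic covariant of the norm form, divided by `240`. -/
def covariant {R : Type*} [CommRing R] (c x e : ℤ) (p q : R) : R :=
  c * p ^ 4 - 90 * x * p ^ 3 * q + (15 * c ^ 2 + 45 * e) * p ^ 2 * q ^ 2 - 450 * c * x * p * q ^ 3 +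
    (10125 * x ^ 2 - 225 * c * e) * q ^ 4

theorem coe_covariant {R : Type*} [CommRing R] (c x e p q : ℤ) :
    ((covariant c x e p q : ℤ) : R) = covariant c x e (p : R) q := by
  simp [covariant]

/-- The residues modulo `25` of `3y + 5` when `2y = m² - 5m` comes from a solution. -/
def residues25 : Finset (ZMod 25) := {5, 11, 14, 21, 24}

theorem UnitPair.eq_zero {c x e : ℤ} (u : UnitPair c x e)
    (hloc : ∀ p q : ZMod 25, p ^ 4 - 30 * c * p ^ 2 * q ^ 2 + 900 * x * p * q ^ 3 -
      225 * e * q ^ 4 = 1 → covariant c x e p q ∈ residues25 →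
      5 * ((u.E 1 * u.H 2 - u.E 2 * u.H 1) * p - (u.E 2 * u.H 0 - u.E 0 * u.H 2) * q) ≠ 0)
    {p q : ℤ} (h : p ^ 4 - 30 * c * p ^ 2 * q ^ 2 + 900 * x * p * q ^ 3 - 225 * e * q ^ 4 = 1)
    (hG : (covariant c x e p q : ZMod 25) ∈ residues25) : q = 0 := by
  refine eq_zero_of_norm_eq_one u.irreducible u.exists_neg u.disc u.nearInt_w u.nearInt_z h ?_
  rintro ⟨k, hk⟩
  refine hloc p q (by exact_mod_cast congrArg (Int.cast : ℤ → ZMod 25) h) hG ?_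
  have := congrArg (Int.cast : ℤ → ZMod 25) hk
  push_cast at this
  rw [this, ← mul_assoc, show (5 : ZMod 25) * 5 = 0 by decide, zero_mul]

instance : Fact (Nat.Prime 13) := ⟨by norm_num⟩

instance : Fact (Nat.Prime 17) := ⟨by norm_num⟩

instance : Fact (Nat.Prime 73) := ⟨by norm_num⟩

/-- Units for the form with `(c, x, e) = (-4, 1, -4)`. -/
def unitsNegSix : UnitPair (-4) 1 (-4) where
  irreducible := irreducible_of_mod (r := 13) (by decide +kernel) (by decide +kernel)
  exists_neg := ⟨-4, by norm_num⟩
  disc := by norm_num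
  w := .mkOfMulEqOne ⟨5, 2, 3, 0⟩
    ⟨-1159, -926, 477, -96⟩ (by rw [mk_mul, one_def]; norm_num)
  z := .mkOfMulEqOne ⟨1, 1, 2, 0⟩
    ⟨-555, -89, 13, -11⟩ (by rw [mk_mul, one_def]; norm_num)
  E := ![1, 4, 0]
  H := ![1, 4, 3]
  nearInt_w := nearInt_one_of_dvd _ _ _ (by decide +kernel)
  nearInt_z := nearInt_one_of_dvd _ _ _ (by decide +kernel)

/-- Units for the form with `(c, x, e) = (-1, 1, -9)`. -/
def unitsNegFour : UnitPair (-1) 1 (-9) where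
  irreducible := irreducible_of_mod (r := 13) (by decide +kernel) (by decide +kernel)
  exists_neg := ⟨-7, by norm_num⟩
  disc := by norm_num
  w := .mkOfMulEqOne ⟨5, 4, 12, 0⟩
    ⟨284861, 12764, -13212, 5280⟩ (by rw [mk_mul, one_def]; norm_num)
  z := .mkOfMulEqOne ⟨86, 41, 30, -4⟩
    ⟨-14434, -4466, 5850, -791⟩ (by rw [mk_mul, one_def]; norm_num)
  E := ![4, 1, 4]
  H := ![4, 2, 4]
  nearInt_w := nearInt_one_of_dvd _ _ _ (by decide +kernel)
  nearInt_z := nearInt_one_of_dvd _ _ _ (by decide +kernel)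

/-- Units for the form with `(c, x, e) = (5, 1, -1)`. -/
def unitsZero : UnitPair 5 1 (-1) where
  irreducible := irreducible_of_mod (r := 73) (by decide +kernel) (by decide +kernel)
  exists_neg := ⟨-14, by norm_num⟩
  disc := by norm_num
  w := .mkOfMulEqOne ⟨52, 223, -180, -28⟩
    ⟨6328, 24878, -88980, 6127⟩ (by rw [mk_mul, one_def]; norm_num)
  z := .mkOfMulEqOne ⟨0, 0, 1, 0⟩
    ⟨250, -40, -1, 4⟩ (by rw [mk_mul, one_def]; norm_num)
  E := ![1, 3, 4]
  H := ![3, 3, 0]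
  nearInt_w := nearInt_one_of_dvd _ _ _ (by decide +kernel)
  nearInt_z := nearInt_one_of_dvd _ _ _ (by decide +kernel)

/-- Units for the form with `(c, x, e) = (14, 5, 56)`. -/
def unitsSix : UnitPair 14 5 56 where
  irreducible := irreducible_of_mod (r := 13) (by decide +kernel) (by decide +kernel)
  exists_neg := ⟨-24, by norm_num⟩
  disc := by norm_num
  w := .mkOfMulEqOne ⟨9133, -1424, 269, 54⟩
    ⟨-1635, 412, -161, -18⟩ (by rw [mk_mul, one_def]; norm_num)
  z := .mkOfMulEqOne ⟨327, -86, 40, 4⟩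
    ⟨-137, 54, -100, 4⟩ (by rw [mk_mul, one_def]; norm_num)
  E := ![4, 2, 3]
  H := ![3, 3, 3]
  nearInt_w := nearInt_one_of_dvd _ _ _ (by decide +kernel)
  nearInt_z := nearInt_one_of_dvd _ _ _ (by decide +kernel)

/-- Units for the form with `(c, x, e) = (26, 13, 216)`. -/
def unitsFourteen : UnitPair 26 13 216 where
  irreducible := irreducible_of_mod (r := 13) (by decide +kernel) (by decide +kernel)
  exists_neg := ⟨-34, by norm_num⟩
  disc := by norm_num
  w := .mkOfMulEqOne ⟨37758707, -10196511, 13571919, -397701⟩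
    ⟨6378515, -816357, 154854, 17460⟩ (by rw [mk_mul, one_def]; norm_num)
  z := .mkOfMulEqOne ⟨-535, 85, -24, -2⟩
    ⟨-367, 47, -9, -1⟩ (by rw [mk_mul, one_def]; norm_num)
  E := ![2, 4, 0]
  H := ![1, 0, 2]
  nearInt_w := nearInt_one_of_dvd _ _ _ (by decide +kernel)
  nearInt_z := nearInt_one_of_dvd _ _ _ (by decide +kernel)

/-- Units for the form with `(c, x, e) = (50, 35, 824)`. -/
def unitsThirty : UnitPair 50 35 824 where
  irreducible := irreducible_of_mod (r := 73) (by decide +kernel) (by decide +kernel)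
  exists_neg := ⟨-47, by norm_num⟩
  disc := by norm_num
  w := .mkOfMulEqOne ⟨-1587267, 173247, -34555, -2109⟩
    ⟨-386083, 37997, -6170, -434⟩ (by rw [mk_mul, one_def]; norm_num)
  z := .mkOfMulEqOne ⟨-15, 2, -1, 0⟩
    ⟨-55, 2, 1, 0⟩ (by rw [mk_mul, one_def]; norm_num)
  E := ![1, 0, 3]
  H := ![0, 2, 3]
  nearInt_w := nearInt_one_of_dvd _ _ _ (by decide +kernel)
  nearInt_z := nearInt_one_of_dvd _ _ _ (by decide +kernel)

/-- Units for the form with `(c, x, e) = (80, 71, 2124)`. -/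
def unitsFifty : UnitPair 80 71 2124 where
  irreducible := irreducible_of_mod (r := 17) (by decide +kernel) (by decide +kernel)
  exists_neg := ⟨-59, by norm_num⟩
  disc := by norm_num
  w := .mkOfMulEqOne ⟨-89029355, 7101083, -960117, -51797⟩
    ⟨-10346375, 888997, -141852, -6790⟩ (by rw [mk_mul, one_def]; norm_num)
  z := .mkOfMulEqOne ⟨6379, -959, 720, -12⟩
    ⟨-3641, 359, -75, -3⟩ (by rw [mk_mul, one_def]; norm_num)
  E := ![2, 1, 1]
  H := ![1, 2, 3]
  nearInt_w := nearInt_one_of_dvd _ _ _ (by decide +kernel)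
  nearInt_z := nearInt_one_of_dvd _ _ _ (by decide +kernel)

/-- Units for the form with `(c, x, e) = (311, 545, 32231)`. -/
def unitsTwoHundredFour : UnitPair 311 545 32231 where
  irreducible := irreducible_of_mod (r := 13) (by decide +kernel) (by decide +kernel)
  exists_neg := ⟨-60, by norm_num⟩
  disc := by norm_num
  w := .mkOfMulEqOne ⟨-145946, 6200, -477, -12⟩
    ⟨-320, 16, -3, 0⟩ (by rw [mk_mul, one_def]; norm_num)
  z := .mkOfMulEqOne ⟨85210, -3618, 278, 7⟩
    ⟨-399894, 16711, -1238, -32⟩ (by rw [mk_mul, one_def]; norm_num)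
  E := ![4, 0, 3]
  H := ![4, 1, 1]
  nearInt_w := nearInt_one_of_dvd _ _ _ (by decide +kernel)
  nearInt_z := nearInt_one_of_dvd _ _ _ (by decide +kernel)

/-- Units for the form with `(c, x, e) = (329, 593, 36071)`. -/
def unitsTwoHundredSixteen : UnitPair 329 593 36071 where
  irreducible := irreducible_of_mod (r := 13) (by decide +kernel) (by decide +kernel)
  exists_neg := ⟨-60, by norm_num⟩
  disc := by norm_num
  w := .mkOfMulEqOne ⟨320, -16, 3, 0⟩
    ⟨163334, -6632, 477, 12⟩ (by rw [mk_mul, one_def]; norm_num)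
  z := .mkOfMulEqOne ⟨236883, -9816, 740, 18⟩
    ⟨9752867, -396496, 28600, 718⟩ (by rw [mk_mul, one_def]; norm_num)
  E := ![3, 1, 0]
  H := ![2, 2, 4]
  nearInt_w := nearInt_one_of_dvd _ _ _ (by decide +kernel)
  nearInt_z := nearInt_one_of_dvd _ _ _ (by decide +kernel)

/-- Units for the form with `(c, x, e) = (3779, 23087, 4760271)`. -/
def unitsTwoThousandFiveHundredSixteen : UnitPair 3779 23087 4760271 where
  irreducible := irreducible_of_mod (r := 13) (by decide +kernel) (by decide +kernel)
  exists_neg := ⟨-60, by norm_num⟩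
  disc := by norm_num
  w := .mkOfMulEqOne ⟨411673180, -4987134, 108672, 791⟩
    ⟨-9352555904, 113637975, -2492352, -18068⟩ (by rw [mk_mul, one_def]; norm_num)
  z := .mkOfMulEqOne ⟨357204304, -4332371, 94620, 688⟩
    ⟨-7888833296, 95561186, -2081040, -15163⟩ (by rw [mk_mul, one_def]; norm_num)
  E := ![2, 2, 4]
  H := ![4, 1, 3]
  nearInt_w := nearInt_one_of_dvd _ _ _ (by decide +kernel)
  nearInt_z := nearInt_one_of_dvd _ _ _ (by decide +kernel)

/-- The residues modulo `61` of `3y + 5` when `2y = m² - 5m` comes from a solution. -/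
def residues61 : Finset (ZMod 61) := {5, 9, 14, 17, 19, 21, 26, 28, 31, 32, 43, 56, 57, 59, 60}

instance : Fact (Nat.Prime 61) := ⟨by norm_num⟩

theorem eq_one_of_pow_five {G : Type*} [Group G] {g : G} {a : ℤ} (h5 : g ^ 5 = 1)
    (ha : g ^ (2 * a) = 1) (hg : ¬ (5 : ℤ) ∣ a) : g = 1 := by
  have h1 := orderOf_dvd_iff_pow_eq_one.2 h5
  have h2 := orderOf_dvd_iff_zpow_eq_one.2 ha
  rcases (Nat.dvd_prime Nat.prime_five).1 h1 with h | h
  · exact orderOf_eq_one_iff.1 h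
  · rw [h] at h2
    push_cast at h2
    omega

theorem eq_zero_neg_six {p q : ℤ}
    (h : p ^ 4 - 30 * (-4 : ℤ) * p ^ 2 * q ^ 2 + 900 * (1 : ℤ) * p * q ^ 3 -
      225 * (-4 : ℤ) * q ^ 4 = 1)
    (h61 : (covariant (-4) 1 (-4) p q : ZMod 61) ∈ residues61) : q = 0 := by
  refine eq_zero_of_norm_eq_one unitsNegSix.irreducible unitsNegSix.exists_neg unitsNegSix.disc
    unitsNegSix.nearInt_w unitsNegSix.nearInt_z h ?_
  intro hpq
  have h5 := not_five_dvd_of_norm h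
  replace hpq : (5 : ℤ) ∣ 12 * p - (-3) * q := hpq
  have hp0 : (p : ZMod 5) ≠ 0 := fun h => h5 ((ZMod.intCast_zmod_eq_zero_iff_dvd _ 5).1 h)
  have hqp : (q : ZMod 5) = p := by
    rw [← sub_eq_zero]
    have : (5 : ℤ) ∣ q - p := by omega
    exact_mod_cast (ZMod.intCast_zmod_eq_zero_iff_dvd _ 5).2 this
  have hu := nearInt_linear_pow (c := -4) (x := 1) (e := -4) h5 0 (q := q) (q' := q) (by simp)
  rw [← coe_linearUnit p q h, hqp, zero_add, div_mul_cancel_right₀ hp0] at hu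
  have hl : ![(p : ZMod 5)⁻¹ * p, -((p : ZMod 5)⁻¹ * p), 0] = ![1, -1, 0] := by
    rw [inv_mul_cancel₀ hp0]
  rw [hl] at hu
  set v := linearUnit p q h with hv
  set w := unitsNegSix.w with hw
  set z := unitsNegSix.z with hz
  obtain ⟨g, hg, hrel⟩ := exists_unit_relation unitsNegSix.irreducible unitsNegSix.exists_neg
    unitsNegSix.disc ![v, w, z]
  have hrel' := relation_of_units _ g hrel
  simp only [Matrix.cons_val] at hrel'
  have key := hu.linear_relation one_ne_zero unitsNegSix.nearInt_w unitsNegSix.nearInt_z hrel'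
  have k0 : (g 0 : ZMod 5) * 1 + g 1 * 1 + g 2 * 1 = 0 := congrFun key 0
  have k2 : (g 0 : ZMod 5) * 0 + g 1 * 0 + g 2 * 3 = 0 := congrFun key 2
  have hd : (5 : ℤ) ∣ g 2 := by
    refine (ZMod.intCast_zmod_eq_zero_iff_dvd _ 5).1 ?_
    linear_combination 2 * k2 - (g 2 : ZMod 5) * five_eq_zero
  obtain ⟨d, hd⟩ := hd
  have hb : (5 : ℤ) ∣ g 0 + g 1 := by
    refine (ZMod.intCast_zmod_eq_zero_iff_dvd _ 5).1 ?_
    push_cast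
    rw [hd] at k0
    push_cast at k0
    linear_combination k0 - (d : ZMod 5) * five_eq_zero
  obtain ⟨b, hb⟩ := hb
  have ha : ¬ (5 : ℤ) ∣ g 0 := fun ha => hg fun i => by
    fin_cases i
    · exact ha
    · change (5 : ℤ) ∣ g 1; omega
    · exact ⟨d, hd⟩
  let φ : QuarticOrder (-4) 1 (-4) →+* ZMod 61 := evalHom (by decide) 42 (by decide)
  let χ : (QuarticOrder (-4) 1 (-4))ˣ →* (ZMod 61)ˣ :=
    (powMonoidHom 12).comp (Units.map φ.toMonoidHom)
  have hχ : ∀ t, χ t ^ 5 = 1 := fun t => by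
    have := ZMod.units_pow_card_sub_one_eq_one 61 (Units.map φ.toMonoidHom t)
    rw [← this]
    exact (pow_mul _ 12 5).symm
  have hχz : ∀ t (n : ℤ), χ t ^ (5 * n) = 1 := fun t n => by
    rw [zpow_mul, show (5 : ℤ) = (5 : ℕ) by rfl, zpow_natCast, hχ, one_zpow]
  have hrel2 : (χ v ^ g 0 * χ w ^ g 1 * χ z ^ g 2) ^ 2 = 1 := by
    have := congrArg χ hrel
    simpa [Fin.prod_univ_three] using this
  have h1 : χ v / χ w = 1 := by
    refine eq_one_of_pow_five (a := g 0) ?_ ?_ ha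
    · rw [div_pow, hχ, hχ, div_one]
    · rw [hd, hχz, mul_one, show g 1 = 5 * b - g 0 by omega, zpow_sub, hχz, one_mul,
        ← div_eq_mul_inv, ← div_zpow] at hrel2
      rw [mul_comm, zpow_mul]
      exact_mod_cast hrel2
  have h2 : φ v ^ 12 = φ w ^ 12 := congrArg Units.val (div_eq_one.1 h1)
  have hv2 : φ v = p - 42 * q := by
    change φ ⟨p, -q, 0, 0⟩ = _
    rw [evalHom_apply]
    push_cast
    ring
  have hw2 : φ w ^ 12 = 58 := by
    change φ ⟨5, 2, 3, 0⟩ ^ 12 = _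
    rw [evalHom_apply]
    decide +kernel
  rw [hv2, hw2] at h2
  have hloc : ∀ p q : ZMod 61, p ^ 4 - 30 * (-4 : ℤ) * p ^ 2 * q ^ 2 + 900 * (1 : ℤ) * p * q ^ 3 -
      225 * (-4 : ℤ) * q ^ 4 = 1 → covariant (-4) 1 (-4) p q ∈ residues61 →
      (p - 42 * q) ^ 12 ≠ 58 := by
    decide +kernel
  exact hloc p q (by exact_mod_cast congrArg (Int.cast : ℤ → ZMod 61) h) h61 h2

/-- The unit `(5s - qξ)² / 5` attached to a representation of `1` by the companion form. -/
def companionUnit (s q : ℤ)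
    (h : 25 * s ^ 4 - 780 * s ^ 2 * q ^ 2 + 2340 * s * q ^ 3 - 1944 * q ^ 4 = 1) :
    (QuarticOrder 26 13 216)ˣ :=
  .mkOfMulEqOne ⟨5 * s ^ 2, -2 * s * q, 3 * q ^ 2, 0⟩
    (let A := 5 * s ^ 3 - 156 * s * q ^ 2 + 468 * q ^ 3
    let B := 5 * s ^ 2 * q - 156 * q ^ 3
    let T := 45 * s ^ 2 * q ^ 4 + 18 * B * q ^ 3
    ⟨5 * A ^ 2 + 216 * T + 303264 * q ^ 6,
      2 * A * B - 52 * T + 3888 * s * q ^ 5 - 73008 * q ^ 6,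
      30 * A * s * q ^ 2 + 3 * B ^ 2 + 52 * T - 14040 * s * q ^ 5 + 78840 * q ^ 6,
      6 * A * q ^ 3 + 6 * s * q ^ 2 * B + 936 * s * q ^ 5 - 1404 * q ^ 6⟩) (by
    simp only [mk_mul, one_def, mk.injEq]
    refine ⟨?_, ?_, ?_, ?_⟩
    · linear_combination (25 * s ^ 4 - 780 * s ^ 2 * q ^ 2 + 2340 * s * q ^ 3 -
        1944 * q ^ 4 + 1) * h
    all_goals ring)

/-- Coordinates modulo `5` of the expansions of the companion units. -/
def companionExpansion : Fin 5 → Fin 3 → ℤ :=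
  ![![4, 2, 2], ![1, 4, 1], ![3, 0, 0], ![0, 0, 4], ![2, 4, 3]]

theorem companion_table : ∀ t ∈ Finset.range 25,
    ¬ 5 ∣ (((⟨5 * t ^ 2, -2 * t, 3, 0⟩ : QuarticOrder 26 13 216) ^ 8) ^ 15).a₀ ∧
    25 ∣ (((⟨5 * t ^ 2, -2 * t, 3, 0⟩ : QuarticOrder 26 13 216) ^ 8) ^ 15).a₁ -
      5 * ((((⟨5 * t ^ 2, -2 * t, 3, 0⟩ : QuarticOrder 26 13 216) ^ 8) ^ 15).a₀ *
        companionExpansion (Fin.ofNat 5 t) 0) ∧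
    125 ∣ (((⟨5 * t ^ 2, -2 * t, 3, 0⟩ : QuarticOrder 26 13 216) ^ 8) ^ 15).a₂ -
      25 * ((((⟨5 * t ^ 2, -2 * t, 3, 0⟩ : QuarticOrder 26 13 216) ^ 8) ^ 15).a₀ *
        companionExpansion (Fin.ofNat 5 t) 1) ∧
    25 ∣ (((⟨5 * t ^ 2, -2 * t, 3, 0⟩ : QuarticOrder 26 13 216) ^ 8) ^ 15).a₃ -
      5 * ((((⟨5 * t ^ 2, -2 * t, 3, 0⟩ : QuarticOrder 26 13 216) ^ 8) ^ 15).a₀ *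
        companionExpansion (Fin.ofNat 5 t) 2) := by
  decide +kernel

theorem companion_det : ∀ i : Fin 5, let l := fun j => (companionExpansion i j : ZMod 5)
    let E := fun j => (unitsFourteen.E j : ZMod 5)
    let H := fun j => (unitsFourteen.H j : ZMod 5)
    (E 1 * H 2 - E 2 * H 1) * l 0 + (E 2 * H 0 - E 0 * H 2) * l 1 +
      (E 0 * H 1 - E 1 * H 0) * l 2 ≠ 0 := by
  decide +kernel

theorem _root_.Int.prime_five : Prime (5 : ℤ) :=
  Int.prime_iff_natAbs_prime.2 (by norm_num)

theorem dvd_pow_sub_pow_of_dvd_sub {R : Type*} [CommRing R] {a b : R} (h : 25 ∣ a - b) :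
    125 ∣ a ^ 120 - b ^ 120 := by
  obtain ⟨d, hd⟩ := h
  obtain rfl : a = b + 25 * d := by linear_combination hd
  have h5 : (125 : R) ∣ (b + 25 * d) ^ 5 - b ^ 5 :=
    ⟨b ^ 4 * d + 50 * b ^ 3 * d ^ 2 + 1250 * b ^ 2 * d ^ 3 + 15625 * b * d ^ 4 + 78125 * d ^ 5,
      by ring⟩
  have := h5.trans (sub_dvd_pow_sub_pow _ _ 24)
  rwa [← pow_mul, ← pow_mul] at this

theorem exists_nearInt_companion {s q : ℤ} (hq : ¬ (5 : ℤ) ∣ q) :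
    ∃ i : Fin 5, NearInt ((⟨5 * s ^ 2, -2 * s * q, 3 * q ^ 2, 0⟩ : QuarticOrder 26 13 216) ^ 120) 1
      ![(companionExpansion i 0 : ZMod 5), companionExpansion i 1, companionExpansion i 2] := by
  obtain ⟨t, ht, k, hk⟩ : ∃ t ∈ Finset.range 25, (25 : ℤ) ∣ s - t * q := by
    have hco : IsCoprime (25 : ℤ) q := by
      rw [show (25 : ℤ) = 5 ^ 2 by norm_num]
      exact (Int.prime_five.coprime_iff_not_dvd.2 hq).pow_left
    obtain ⟨u, v, huv⟩ := hco
    refine ⟨(s * v % 25).toNat, by simp; omega, ?_⟩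
    rw [Int.toNat_of_nonneg (Int.emod_nonneg _ (by norm_num))]
    refine ⟨s * u + s * v / 25 * q, ?_⟩
    linear_combination (-s) * huv - q * Int.emod_add_mul_ediv (s * v) 25
  obtain rfl : s = t * q + 25 * k := by linear_combination hk
  refine ⟨Fin.ofNat 5 t, nearInt_one_of_dvd _ _ _ ?_⟩
  have htab := companion_table t ht
  rw [← pow_mul] at htab
  norm_num only at htab
  obtain ⟨⟨b₀, b₁, b₂, b₃⟩, hb⟩ := dvd_pow_sub_pow_of_dvd_sub
    (a := (⟨5 * (t * q + 25 * k) ^ 2, -2 * (t * q + 25 * k) * q, 3 * q ^ 2, 0⟩ :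
      QuarticOrder 26 13 216))
    (b := (q ^ 2 : ℤ) * ⟨5 * t ^ 2, -2 * t, 3, 0⟩) (by
      refine ⟨⟨10 * t * q * k + 125 * k ^ 2, -2 * k * q, 0, 0⟩, ?_⟩
      rw [show (25 : QuarticOrder 26 13 216) = (25 : ℤ) by simp, intCast_mul_mk, intCast_mul_mk,
        sub_eq_add_neg, mk_neg, mk_add, mk.injEq]
      refine ⟨?_, ?_, ?_, ?_⟩ <;> ring)
  rw [mul_pow, ← Int.cast_pow] at hb
  generalize (⟨5 * t ^ 2, -2 * t, 3, 0⟩ : QuarticOrder 26 13 216) ^ 120 = V at *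
  obtain ⟨v₀, v₁, v₂, v₃⟩ := V
  have h125 : (125 : QuarticOrder 26 13 216) = (125 : ℤ) := by simp
  rw [sub_eq_iff_eq_add, h125, intCast_mul_mk, intCast_mul_mk, mk_add] at hb
  rw [hb]
  have hm : ¬ (5 : ℤ) ∣ (q ^ 2) ^ 120 := fun h =>
    hq (Int.prime_five.dvd_of_dvd_pow (Int.prime_five.dvd_of_dvd_pow h))
  generalize (q ^ 2) ^ 120 = m at *
  obtain ⟨h0, ⟨w₁, h1⟩, ⟨w₂, h2⟩, w₃, h3⟩ := htab
  simp only at h0 h1 h2 h3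
  refine ⟨fun h => ?_, ⟨5 * b₁ + m * w₁ - 25 * b₀ * companionExpansion (Fin.ofNat 5 t) 0, ?_⟩,
    ⟨b₂ + m * w₂ - 25 * b₀ * companionExpansion (Fin.ofNat 5 t) 1, ?_⟩,
    ⟨5 * b₃ + m * w₃ - 25 * b₀ * companionExpansion (Fin.ofNat 5 t) 2, ?_⟩⟩
  · have : (5 : ℤ) ∣ m * v₀ := by
      have := dvd_sub h (Dvd.intro (25 * b₀) rfl : (5 : ℤ) ∣ 5 * (25 * b₀))
      ring_nf at this ⊢
      exact this
    exact (Int.prime_five.dvd_or_dvd this).elim hm h0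
  · linear_combination m * h1
  · linear_combination m * h2
  · linear_combination m * h3

/-- The companion form does not represent `1`. -/
theorem companion_ne_one (s q : ℤ) :
    25 * s ^ 4 - 780 * s ^ 2 * q ^ 2 + 2340 * s * q ^ 3 - 1944 * q ^ 4 ≠ 1 := by
  intro h
  have hq : ¬ (5 : ℤ) ∣ q := by
    rintro ⟨q, rfl⟩
    have : (5 : ℤ) ∣ 1 := ⟨5 * s ^ 4 - 3900 * s ^ 2 * q ^ 2 + 58500 * s * q ^ 3 - 243000 * q ^ 4,
      by linear_combination -h⟩
    omega
  obtain ⟨i, hi⟩ := exists_nearInt_companion (s := s) hq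
  exact false_of_independent unitsFourteen.irreducible unitsFourteen.exists_neg unitsFourteen.disc
    (u := companionUnit s q h) (k := 0) hi unitsFourteen.nearInt_w unitsFourteen.nearInt_z
    (companion_det i)

/-- The parameters `(c, x, e)` of the norm forms that arise from the reduction. -/
def standardForms : List (ℤ × ℤ × ℤ) :=
  [(-4, 1, -4), (-1, 1, -9), (5, 1, -1), (14, 5, 56), (26, 13, 216), (50, 35, 824), (80, 71, 2124),
    (311, 545, 32231), (329, 593, 36071), (3779, 23087, 4760271)]

theorem eq_zero_of_mem_standardForms {c x e p q : ℤ} (hmem : (c, x, e) ∈ standardForms)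
    (h : p ^ 4 - 30 * c * p ^ 2 * q ^ 2 + 900 * x * p * q ^ 3 - 225 * e * q ^ 4 = 1)
    (h25 : (covariant c x e p q : ZMod 25) ∈ residues25)
    (h61 : (covariant c x e p q : ZMod 61) ∈ residues61) : q = 0 := by
  simp only [standardForms, List.mem_cons, Prod.mk.injEq, List.not_mem_nil, or_false] at hmem
  rcases hmem with ⟨rfl, rfl, rfl⟩ | ⟨rfl, rfl, rfl⟩ | ⟨rfl, rfl, rfl⟩ | ⟨rfl, rfl, rfl⟩ |
    ⟨rfl, rfl, rfl⟩ | ⟨rfl, rfl, rfl⟩ | ⟨rfl, rfl, rfl⟩ | ⟨rfl, rfl, rfl⟩ | ⟨rfl, rfl, rfl⟩ |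
    ⟨rfl, rfl, rfl⟩
  · exact eq_zero_neg_six h h61
  · exact unitsNegFour.eq_zero (by decide +kernel) h h25
  · exact unitsZero.eq_zero (by decide +kernel) h h25
  · exact unitsSix.eq_zero (by decide +kernel) h h25
  · exact unitsFourteen.eq_zero (by decide +kernel) h h25
  · exact unitsThirty.eq_zero (by decide +kernel) h h25
  · exact unitsFifty.eq_zero (by decide +kernel) h h25
  · exact unitsTwoHundredFour.eq_zero (by decide +kernel) h h25
  · exact unitsTwoHundredSixteen.eq_zero (by decide +kernel) h h25
  · exact unitsTwoThousandFiveHundredSixteen.eq_zero (by decide +kernel) h h25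

end QuarticOrder

theorem curve_of_choose_eq {n m : ℕ} (hn : 8 ≤ n) (hm : 12 ≤ m) (h : n.choose 4 = m.choose 6) :
    30 * (((n : ℤ) ^ 2 - 3 * n + 1) ^ 2 - 1) =
      ((m : ℤ) ^ 2 - 5 * m) * (m ^ 2 - 5 * m + 4) * (m ^ 2 - 5 * m + 6) := by
  have h4 := Nat.descFactorial_eq_factorial_mul_choose n 4
  have h6 := Nat.descFactorial_eq_factorial_mul_choose m 6
  obtain ⟨n, rfl⟩ := Nat.exists_eq_add_of_le' hn
  obtain ⟨m, rfl⟩ := Nat.exists_eq_add_of_le' hm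
  simp [Nat.descFactorial, Nat.factorial] at h4 h6
  zify at h4 h6 h ⊢
  rw [← h] at h6
  linear_combination 30 * h4 - h6

theorem mem_residues25 {m n y : ℤ} (hy : 2 * y = m ^ 2 - 5 * m)
    (h : 30 * ((n ^ 2 - 3 * n + 1) ^ 2 - 1) =
      (m ^ 2 - 5 * m) * (m ^ 2 - 5 * m + 4) * (m ^ 2 - 5 * m + 6)) :
    ((3 * y + 5 : ℤ) : ZMod 25) ∈ QuarticOrder.residues25 := by
  have hn : ∀ n : ZMod 625, 30 * ((n ^ 2 - 3 * n + 1) ^ 2 - 1) = 95 ∨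
      25 * (30 * ((n ^ 2 - 3 * n + 1) ^ 2 - 1)) = 0 := by
    decide +kernel
  have hm : ∀ m : ZMod 625,
      ((m ^ 2 - 5 * m) * (m ^ 2 - 5 * m + 4) * (m ^ 2 - 5 * m + 6) = 95 ∨
        25 * ((m ^ 2 - 5 * m) * (m ^ 2 - 5 * m + 4) * (m ^ 2 - 5 * m + 6)) = 0) →
      13 * ZMod.castHom (by norm_num : 25 ∣ 625) (ZMod 25) (3 * (m ^ 2 - 5 * m) + 10) ∈
        QuarticOrder.residues25 := by
    decide +kernel
  have h' : (30 * ((n ^ 2 - 3 * n + 1) ^ 2 - 1) : ZMod 625) =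
      (m ^ 2 - 5 * m) * (m ^ 2 - 5 * m + 4) * (m ^ 2 - 5 * m + 6) := by
    exact_mod_cast congrArg (Int.cast : ℤ → ZMod 625) h
  have key := hm m (h' ▸ hn n)
  have h2 : (3 * (m ^ 2 - 5 * m) + 10 : ZMod 625) = ((2 * (3 * y + 5) : ℤ) : ZMod 625) := by
    rw [show 2 * (3 * y + 5) = 3 * (m ^ 2 - 5 * m) + 10 by linear_combination 3 * hy]
    push_cast
    ring
  rwa [h2, map_intCast, Int.cast_mul, ← mul_assoc,
    show (13 : ZMod 25) * ((2 : ℤ) : ZMod 25) = 1 by decide, one_mul] at key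

theorem mem_residues61 {m n y : ℤ} (hy : 2 * y = m ^ 2 - 5 * m)
    (h : 30 * ((n ^ 2 - 3 * n + 1) ^ 2 - 1) =
      (m ^ 2 - 5 * m) * (m ^ 2 - 5 * m + 4) * (m ^ 2 - 5 * m + 6)) :
    ((3 * y + 5 : ℤ) : ZMod 61) ∈ QuarticOrder.residues61 := by
  have key : ∀ m n : ZMod 61, 30 * ((n ^ 2 - 3 * n + 1) ^ 2 - 1) =
      (m ^ 2 - 5 * m) * (m ^ 2 - 5 * m + 4) * (m ^ 2 - 5 * m + 6) →
      3 * (31 * (m ^ 2 - 5 * m)) + 5 ∈ QuarticOrder.residues61 := by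
    decide +kernel
  have hres := key m n (by exact_mod_cast congrArg (Int.cast : ℤ → ZMod 61) h)
  have hy' := congrArg (Int.cast : ℤ → ZMod 61) hy
  push_cast at hy' ⊢
  rwa [← hy', ← mul_assoc 31, show (31 : ZMod 61) * 2 = 1 by decide, one_mul] at hres

/-- A solution in the standard range is not represented by any of the standard forms. -/
theorem false_of_mem_standardForms {m n y c x e p q : ℤ} (hm : 12 ≤ m) (hn : 8 ≤ n)
    (hy : 2 * y = m ^ 2 - 5 * m)
    (h : 30 * ((n ^ 2 - 3 * n + 1) ^ 2 - 1) =
      (m ^ 2 - 5 * m) * (m ^ 2 - 5 * m + 4) * (m ^ 2 - 5 * m + 6))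
    (hmem : (c, x, e) ∈ QuarticOrder.standardForms)
    (hpq : p ^ 4 - 30 * c * p ^ 2 * q ^ 2 + 900 * x * p * q ^ 3 - 225 * e * q ^ 4 = 1)
    (hcov : QuarticOrder.covariant c x e p q = 3 * y + 5) : False := by
  have h25 := mem_residues25 hy h
  have hq := QuarticOrder.eq_zero_of_mem_standardForms hmem hpq
    (by rw [← QuarticOrder.coe_covariant, hcov]; exact h25)
    (by rw [← QuarticOrder.coe_covariant, hcov]; exact mem_residues61 hy h)
  subst hq
  have hc : c = 3 * y + 5 := by
    simp only [QuarticOrder.covariant] at hcov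
    linear_combination hcov - c * hpq
  have hy42 : 42 ≤ y := by nlinarith
  rw [← hc] at h25
  simp only [QuarticOrder.standardForms, List.mem_cons, Prod.mk.injEq, List.not_mem_nil,
    or_false] at hmem
  have h311 : c = 311 := by
    rcases hmem with ⟨rfl, -⟩ | ⟨rfl, -⟩ | ⟨rfl, -⟩ | ⟨rfl, -⟩ | ⟨rfl, -⟩ | ⟨rfl, -⟩ | ⟨rfl, -⟩ |
      ⟨rfl, -⟩ | ⟨rfl, -⟩ | ⟨rfl, -⟩ <;> first | omega | exact absurd h25 (by decide)
  obtain rfl : y = 102 := by omega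
  rw [← hy] at h
  have h25n : n < 25 := by
    by_contra! h25n
    nlinarith [mul_le_mul h25n h25n (by norm_num) (by omega), sq_nonneg (n ^ 2 - 3 * n - 550)]
  interval_cases n <;> omega

/-- The binary quartic form `ax⁴ + bx³y + cx²y² + dxy³ + ey⁴`. -/
@[ext]
structure BinaryQuartic where
  /-- The coefficient of `x⁴`. -/
  a : ℤ
  /-- The coefficient of `x³y`. -/
  b : ℤ
  /-- The coefficient of `x²y²`. -/
  c : ℤ
  /-- The coefficient of `xy³`. -/
  d : ℤ
  /-- The coefficient of `y⁴`. -/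
  e : ℤ
  deriving DecidableEq

namespace BinaryQuartic

/-- The value of a form. -/
def eval {R : Type*} [CommRing R] (G : BinaryQuartic) (x y : R) : R :=
  G.a * x ^ 4 + G.b * x ^ 3 * y + G.c * x ^ 2 * y ^ 2 + G.d * x * y ^ 3 + G.e * y ^ 4

/-- The form `G(Px + Ry, Qx + Sy)`. -/
def comp (G : BinaryQuartic) (P R Q S : ℤ) : BinaryQuartic where
  a := G.a * P ^ 4 + G.b * P ^ 3 * Q + G.c * P ^ 2 * Q ^ 2 + G.d * P * Q ^ 3 + G.e * Q ^ 4
  b := G.a * (4 * P ^ 3 * R) + G.b * (P ^ 3 * S + 3 * P ^ 2 * R * Q) +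
    G.c * (2 * P ^ 2 * Q * S + 2 * P * R * Q ^ 2) + G.d * (3 * P * Q ^ 2 * S + R * Q ^ 3) +
    G.e * (4 * Q ^ 3 * S)
  c := G.a * (6 * P ^ 2 * R ^ 2) + G.b * (3 * P ^ 2 * R * S + 3 * P * R ^ 2 * Q) +
    G.c * (P ^ 2 * S ^ 2 + 4 * P * R * Q * S + R ^ 2 * Q ^ 2) +
    G.d * (3 * P * Q * S ^ 2 + 3 * R * Q ^ 2 * S) + G.e * (6 * Q ^ 2 * S ^ 2)
  d := G.a * (4 * P * R ^ 3) + G.b * (3 * P * R ^ 2 * S + R ^ 3 * Q) +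
    G.c * (2 * P * R * S ^ 2 + 2 * R ^ 2 * Q * S) + G.d * (P * S ^ 3 + 3 * R * Q * S ^ 2) +
    G.e * (4 * Q * S ^ 3)
  e := G.a * R ^ 4 + G.b * R ^ 3 * S + G.c * R ^ 2 * S ^ 2 + G.d * R * S ^ 3 + G.e * S ^ 4

/-- The quadratic invariant. -/
def invI (G : BinaryQuartic) : ℤ := 12 * G.a * G.e - 3 * G.b * G.d + G.c ^ 2

/-- The cubic invariant. -/
def invJ (G : BinaryQuartic) : ℤ :=
  72 * G.a * G.c * G.e + 9 * G.b * G.c * G.d - 27 * G.a * G.d ^ 2 - 27 * G.e * G.b ^ 2 -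
    2 * G.c ^ 3

/-- The quartic covariant. -/
def hess (G : BinaryQuartic) : BinaryQuartic where
  a := 3 * G.b ^ 2 - 8 * G.a * G.c
  b := 4 * (G.b * G.c - 6 * G.a * G.d)
  c := 2 * (2 * G.c ^ 2 - 24 * G.a * G.e - 3 * G.b * G.d)
  d := 4 * (G.c * G.d - 6 * G.b * G.e)
  e := 3 * G.d ^ 2 - 8 * G.c * G.e

variable (G : BinaryQuartic)

theorem eval_comp {R' : Type*} [CommRing R'] (P R Q S : ℤ) (x y : R') :
    (G.comp P R Q S).eval x y = G.eval (P * x + R * y) (Q * x + S * y) := by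
  simp only [eval, comp]; push_cast; ring

theorem eval_comp_adj (P R Q S x y : ℤ) :
    (G.comp P R Q S).eval (S * x - R * y) (P * y - Q * x) =
      (P * S - R * Q) ^ 4 * G.eval x y := by
  simp only [eval, comp]; push_cast; ring

theorem invI_comp (P R Q S : ℤ) :
    (G.comp P R Q S).invI = (P * S - R * Q) ^ 4 * G.invI := by
  simp only [invI, comp]; ring

theorem invJ_comp (P R Q S : ℤ) :
    (G.comp P R Q S).invJ = (P * S - R * Q) ^ 6 * G.invJ := by
  simp only [invJ, comp]; ring

theorem hess_comp {P R Q S : ℤ} (h : (P * S - R * Q) ^ 2 = 1) :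
    (G.comp P R Q S).hess = G.hess.comp P R Q S := by
  have key : ∀ {u v : ℤ}, u = (P * S - R * Q) ^ 2 * v → u = v := fun huv => by
    rw [huv, h, one_mul]
  ext <;> refine key ?_ <;> simp only [hess, comp] <;> ring

theorem syzygy : 27 * (G.b ^ 3 + 8 * G.a ^ 2 * G.d - 4 * G.a * G.b * G.c) ^ 2 =
    G.hess.a ^ 3 - 48 * G.a ^ 2 * G.invI * G.hess.a - 64 * G.a ^ 3 * G.invJ := by
  simp only [hess, invI, invJ]; ring

/-- A form with the invariants of the reduction, representing `1` at a point where the covariant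
has the prescribed value `240N`. -/
structure IsAdmissible (N : ℤ) : Prop where
  invI_eq : G.invI = 25200
  invJ_eq : G.invJ = -17550000
  dvd_hess : 240 ∣ G.hess.a ∧ 240 ∣ G.hess.b ∧ 240 ∣ G.hess.c ∧ 240 ∣ G.hess.d ∧ 240 ∣ G.hess.e
  exists_eval : ∃ p q : ℤ, G.eval p q = 1 ∧ G.hess.eval p q = 240 * N

variable {G}

theorem IsAdmissible.comp {N : ℤ} (hG : G.IsAdmissible N) {P R Q S : ℤ} (h : P * S - R * Q = 1) :
    (G.comp P R Q S).IsAdmissible N := by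
  have hh : (G.comp P R Q S).hess = G.hess.comp P R Q S := G.hess_comp (by rw [h, one_pow])
  obtain ⟨h1, h2, ⟨⟨a, ha⟩, ⟨b, hb⟩, ⟨c, hc⟩, ⟨d, hd⟩, e, he⟩, p, q, h3, h4⟩ := hG
  refine ⟨by rw [invI_comp, h, h1]; norm_num, by rw [invJ_comp, h, h2]; norm_num, ?_,
    S * p - R * q, P * q - Q * p, ?_, ?_⟩
  · rw [hh]
    simp only [BinaryQuartic.comp, ha, hb, hc, hd, he, mul_assoc, ← mul_add, dvd_mul_right,
      and_self]
  · rw [eval_comp_adj, h, h3]; norm_num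
  · rw [hh, eval_comp_adj, h, h4]; norm_num

/-- The norm form of the order with parameters `(c, x, e)`. -/
def ofParams (c x e : ℤ) : BinaryQuartic := ⟨1, 0, -30 * c, 900 * x, -225 * e⟩

theorem isAdmissible_ofParams {x y : ℤ} (h : 15 * (x ^ 2 - 1) = 4 * y * (y + 2) * (y + 3)) :
    (ofParams (3 * y + 5) x (3 * y ^ 2 + 10 * y - 1)).IsAdmissible (3 * y + 5) := by
  refine ⟨?_, ?_, ?_, 1, 0, ?_, ?_⟩
  · simp only [ofParams, invI]; ring
  · simp only [ofParams, invJ]; linear_combination (-1458000) * h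
  · refine ⟨⟨3 * y + 5, ?_⟩, ⟨-90 * x, ?_⟩,
      ⟨15 * (3 * y + 5) ^ 2 + 45 * (3 * y ^ 2 + 10 * y - 1), ?_⟩,
      ⟨-450 * (3 * y + 5) * x, ?_⟩,
      ⟨10125 * x ^ 2 - 225 * (3 * y + 5) * (3 * y ^ 2 + 10 * y - 1), ?_⟩⟩ <;>
    simp only [ofParams, hess] <;> ring
  · simp [ofParams, eval]
  · simp [ofParams, eval, hess]; ring

open UpperHalfPlane in
theorem exists_comp_root (G : BinaryQuartic) {z : ℂ} (hz : 0 < z.im) (h : G.eval z 1 = 0) :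
    ∃ P R Q S : ℤ, P * S - R * Q = 1 ∧
      ∃ w : ℂ, 3 ≤ 4 * w.im ^ 2 ∧ (G.comp P R Q S).eval w 1 = 0 := by
  obtain ⟨g, hg⟩ := ModularGroup.exists_smul_mem_fd ⟨z, hz⟩
  refine ⟨g⁻¹ 0 0, g⁻¹ 0 1, g⁻¹ 1 0, g⁻¹ 1 1, ?_, ((g • (⟨z, hz⟩ : ℍ) : ℍ) : ℂ),
    ModularGroup.three_le_four_mul_im_sq_of_mem_fd hg, ?_⟩
  · rw [← Matrix.det_fin_two, Matrix.SpecialLinearGroup.det_coe]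
  · set w : ℍ := g • (⟨z, hz⟩ : ℍ) with hw
    have hzw := coe_specialLinearGroup_apply g⁻¹ w
    rw [hw, inv_smul_smul, ← hw] at hzw
    simp only [algebraMap_int_eq, eq_intCast, Complex.ofReal_intCast] at hzw
    have hd : ((g⁻¹ 1 0 : ℤ) : ℂ) * w + (g⁻¹ 1 1 : ℤ) ≠ 0 := by
      intro h0
      rw [h0, div_zero] at hzw
      exact hz.ne' (by rw [show z = 0 from hzw, Complex.zero_im])
    rw [eval_comp, mul_one, mul_one]
    have hz' : (g⁻¹ 0 0 : ℤ) * (w : ℂ) + (g⁻¹ 0 1 : ℤ) =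
        ((g⁻¹ 1 0 : ℤ) * (w : ℂ) + (g⁻¹ 1 1 : ℤ)) * z := by
      rw [show z = _ from hzw, mul_div_cancel₀ _ hd]
    rw [hz']
    simp only [eval] at h ⊢
    linear_combination ((g⁻¹ 1 0 : ℤ) * (w : ℂ) + (g⁻¹ 1 1 : ℤ)) ^ 4 * h

/-- The inequalities behind `bounds_of_root`, with `T` the squared imaginary part of the root. -/
theorem bounds_of_parts {a k : ℤ} {T u α : ℝ} (ha : a ≠ 0) (hT : 3 / 4 ≤ T) (hα : α = a * T)
    (hu : u ^ 3 - 18900 * u - 2193750 = 0) (hρ : 0 ≤ 12 * α * (u - α) + u ^ 2 - 25200)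
    (hk : 240 * k * T = 4 * α * u - 12 * α ^ 2 + (u ^ 2 - 25200)) :
    -3 ≤ a ∧ a ≤ 239 ∧ (0 < a → -7 * a ≤ k ∧ k ≤ 3 * a + 34) := by
  have ha' : (a : ℝ) ≠ 0 := by exact_mod_cast ha
  have hu₁ : 176 < u := by
    by_contra! h
    have := mul_nonneg (sub_nonneg.2 h) (show 0 ≤ (u + 88) ^ 2 + 4332 by positivity)
    linarith
  have hu₂ : u < 177 := by
    by_contra! h
    have := mul_nonneg (sub_nonneg.2 h) (show 0 ≤ (u + 88) ^ 2 + 88 * u by positivity)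
    nlinarith
  have hU₁ : 5776 < u ^ 2 - 25200 := by nlinarith
  have hU₂ : u ^ 2 - 25200 < 6129 := by nlinarith
  have hα₁ : -3 < α := by
    by_contra! h
    have := mul_nonneg (show 0 ≤ -α by linarith) (show 0 ≤ u - 176 by linarith)
    linarith [sq_nonneg α]
  have hα₂ : α < 179.85 := by
    by_contra! h
    have := mul_nonneg (show 0 ≤ α by linarith) (show 0 ≤ 177 - u by linarith)
    linarith [sq_nonneg (α - 179.85)]
  have key : (240 * k : ℝ) * α = a * (4 * α * u - 12 * α ^ 2 + (u ^ 2 - 25200)) := by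
    linear_combination (240 * k : ℝ) * hα + a * hk
  rcases lt_or_gt_of_ne ha' with hneg | hpos
  · have hna : α ≤ 3 / 4 * a := by nlinarith
    refine ⟨?_, ?_, fun h => absurd h (not_lt.2 ?_)⟩
    · have : (-4 : ℝ) < a := by linarith
      have : (-4 : ℤ) < a := by exact_mod_cast this
      omega
    · have : (a : ℝ) < 239 := by linarith
      exact_mod_cast this.le
    · exact_mod_cast hneg.le
  · have hna : 3 / 4 * a ≤ α := by nlinarith
    have hα₀ : 0 < α := by linarith
    refine ⟨?_, ?_, fun _ => ⟨?_, ?_⟩⟩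
    · have : (-3 : ℝ) < a := by linarith
      exact_mod_cast this.le
    · have : (a : ℝ) < 240 := by linarith
      have : a < 240 := by exact_mod_cast this
      omega
    · have : (-7 * a : ℝ) ≤ k := by
        refine le_of_mul_le_mul_right ?_ hα₀
        linarith [mul_pos hpos hα₀, mul_nonneg (mul_pos hpos hα₀).le (sub_nonneg.2 hu₁.le),
          mul_nonneg (mul_pos hpos hα₀).le (sub_nonneg.2 hα₂.le),
          mul_nonneg hpos.le (sub_nonneg.2 hU₁.le)]
      exact_mod_cast this
    · have : (k : ℝ) < 3 * a + 35 := by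
        refine lt_of_mul_lt_mul_right ?_ hα₀.le
        linarith [mul_pos hpos hα₀, mul_nonneg (mul_pos hpos hα₀).le (sub_nonneg.2 hu₂.le),
          mul_nonneg hpos.le (sq_nonneg α),
          mul_nonneg hpos.le (sub_nonneg.2 hU₂.le)]
      have : k < 3 * a + 35 := by exact_mod_cast this
      omega

/-- Bounds in terms of the real and imaginary parts of a root. -/
theorem bounds_of_root {G : BinaryQuartic} (hI : G.invI = 25200) (hJ : G.invJ = -17550000)
    {w : ℂ} (hw : 3 ≤ 4 * w.im ^ 2) (h : G.eval w 1 = 0) {k : ℤ} (hk : G.hess.a = 240 * k)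
    (ha : G.a ≠ 0) :
    -3 ≤ G.a ∧ G.a ≤ 239 ∧ (0 < G.a → -7 * G.a ≤ k ∧ k ≤ 3 * G.a + 34) := by
  obtain ⟨x, t⟩ := w
  simp only at hw
  obtain ⟨a, b, c, d, e⟩ := G
  simp only [eval, invI, invJ, hess] at *
  have hre := congrArg Complex.re h
  have him := congrArg Complex.im h
  simp [pow_succ] at hre him
  have hT : (3 : ℝ) / 4 ≤ t ^ 2 := by linarith
  have ht : t ≠ 0 := by rintro rfl; norm_num at hT
  have hI' : (12 * a * e - 3 * b * d + c ^ 2 : ℝ) = 25200 := by exact_mod_cast hI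
  have hJ' : (72 * a * c * e + 9 * b * c * d - 27 * a * d ^ 2 - 27 * e * b ^ 2 - 2 * c ^ 3 : ℝ) =
    -17550000 := by exact_mod_cast hJ
  have hk' : (3 * b ^ 2 - 8 * a * c : ℝ) = 240 * k := by exact_mod_cast hk
  clear h hI hJ hk
  have ha' : (a : ℝ) ≠ 0 := by exact_mod_cast ha
  obtain ⟨u, hu⟩ : ∃ u : ℝ, u = 6 * a * x ^ 2 + 3 * b * x + c := ⟨_, rfl⟩
  obtain ⟨v, hv⟩ : ∃ v : ℝ, v = 4 * a * x + b := ⟨_, rfl⟩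
  have hd : 4 * a * x ^ 3 + 3 * b * x ^ 2 + 2 * c * x + d = v * t ^ 2 := by
    refine mul_left_cancel₀ ht ?_
    rw [hv]
    linear_combination him
  have he : a * x ^ 4 + b * x ^ 3 + c * x ^ 2 + d * x + e = u * t ^ 2 - a * t ^ 4 := by
    rw [hu]
    linear_combination hre
  obtain ⟨α, hα⟩ : ∃ α : ℝ, α = a * t ^ 2 := ⟨_, rfl⟩
  obtain ⟨ρ, hρ⟩ : ∃ ρ : ℝ, ρ = v ^ 2 * t ^ 2 := ⟨_, rfl⟩
  have h1 : 3 * ρ = 12 * α * (u - α) + u ^ 2 - 25200 := by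
    rw [hρ, hα, ← hI', hu, hv]
    rw [hu] at he
    rw [hv] at hd
    linear_combination (12 * a) * he - 3 * (4 * a * x + b) * hd
  have h2 : 72 * α * u * (u - α) - 18 * u * ρ - 2 * u ^ 3 = -17550000 := by
    rw [hρ, hα, ← hJ', hu, hv]
    rw [hu] at he
    rw [hv] at hd
    linear_combination
      -(72 * a * (6 * a * x ^ 2 + 3 * b * x + c) - 27 * (4 * a * x + b) ^ 2) * he -
        (9 * (4 * a * x + b) * (6 * a * x ^ 2 + 3 * b * x + c) -
          27 * a * (4 * a * x ^ 3 + 3 * b * x ^ 2 + 2 * c * x + d + (4 * a * x + b) * t ^ 2)) * hd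
  have h3 : 240 * k * t ^ 2 = 3 * ρ - 8 * α * u := by
    rw [← hk', hρ, hα, hu, hv]
    ring
  have h4 : u ^ 3 - 18900 * u - 2193750 = 0 := by
    linear_combination (-1 / 8) * h2 - (3 / 4) * u * h1
  have hρ₀ : 0 ≤ ρ := by rw [hρ]; positivity
  exact bounds_of_parts ha hT hα h4 (by linarith) (by linear_combination h3 + h1)

/-- The congruence conditions on the values of `ofParams c x e`. -/
def isLead (a : ℤ) : Bool := (a % 3 == 1 || a % 9 == 0) && (a % 5 == 1 || a % 25 == 0)

theorem isLead_comp (c x e P R Q S : ℤ) : isLead ((ofParams c x e).comp P R Q S).a = true := by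
  have ha : ((ofParams c x e).comp P R Q S).a = P ^ 2 * (P ^ 2 - 30 * (c * Q ^ 2)) +
      225 * (4 * x * P * Q ^ 3 - e * Q ^ 4) := by
    simp only [ofParams, comp]; ring
  rw [ha]
  generalize 4 * x * P * Q ^ 3 - e * Q ^ 4 = u
  generalize c * Q ^ 2 = v
  simp only [isLead, Bool.and_eq_true, Bool.or_eq_true, beq_iff_eq]
  constructor
  · obtain ⟨k, hk | hk | hk⟩ : ∃ k, P = 3 * k ∨ P = 3 * k + 1 ∨ P = 3 * k + 2 :=
      ⟨P / 3, by omega⟩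
    · right
      rw [show P ^ 2 * (P ^ 2 - 30 * v) + 225 * u =
        9 * (k ^ 2 * (P ^ 2 - 30 * v) + 25 * u) by rw [hk]; ring, Int.mul_emod_right]
    · left
      rw [show P ^ 2 * (P ^ 2 - 30 * v) + 225 * u = 1 + 3 * (27 * k ^ 4 + 36 * k ^ 3 + 18 * k ^ 2 +
        4 * k - 10 * v * P ^ 2 + 75 * u) by rw [hk]; ring, Int.add_mul_emod_self_left]
      rfl
    · left
      rw [show P ^ 2 * (P ^ 2 - 30 * v) + 225 * u = 1 + 3 * (27 * k ^ 4 + 72 * k ^ 3 + 72 * k ^ 2 +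
        32 * k + 5 - 10 * v * P ^ 2 + 75 * u) by rw [hk]; ring, Int.add_mul_emod_self_left]
      rfl
  · obtain ⟨k, hk⟩ : ∃ k, P ^ 2 = 5 * k ∧ 5 ∣ P ∨ P ^ 2 = 5 * k + 1 ∨ P ^ 2 = 5 * k - 1 := by
      obtain ⟨j, hj | hj | hj | hj | hj⟩ : ∃ j, P = 5 * j ∨ P = 5 * j + 1 ∨ P = 5 * j + 2 ∨
        P = 5 * j - 2 ∨ P = 5 * j - 1 := ⟨(P + 2) / 5, by omega⟩
      · exact ⟨5 * j ^ 2, .inl ⟨by rw [hj]; ring, _, hj⟩⟩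
      · exact ⟨5 * j ^ 2 + 2 * j, .inr (.inl (by rw [hj]; ring))⟩
      · exact ⟨5 * j ^ 2 + 4 * j + 1, .inr (.inr (by rw [hj]; ring))⟩
      · exact ⟨5 * j ^ 2 - 4 * j + 1, .inr (.inr (by rw [hj]; ring))⟩
      · exact ⟨5 * j ^ 2 - 2 * j, .inr (.inl (by rw [hj]; ring))⟩
    obtain ⟨-, j, hj⟩ | hk | hk := hk
    · right
      rw [show P ^ 2 * (P ^ 2 - 30 * v) + 225 * u =
        25 * (j ^ 2 * (P ^ 2 - 30 * v) + 9 * u) by rw [hj]; ring, Int.mul_emod_right]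
    · left
      rw [show P ^ 2 * (P ^ 2 - 30 * v) + 225 * u = 1 + 5 * (5 * k ^ 2 + 2 * k - 6 * v * P ^ 2 +
        45 * u) by rw [hk]; ring, Int.add_mul_emod_self_left]
      rfl
    · left
      rw [show P ^ 2 * (P ^ 2 - 30 * v) + 225 * u = 1 + 5 * (5 * k ^ 2 - 2 * k - 6 * v * P ^ 2 +
        45 * u) by rw [hk]; ring, Int.add_mul_emod_self_left]
      rfl

theorem comp_a_ne_zero {c x e P R Q S : ℤ} (he : ¬ 5 ∣ e) (h : P * S - R * Q = 1) :
    ((ofParams c x e).comp P R Q S).a ≠ 0 := by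
  intro h0
  have h0' : P ^ 4 - 30 * c * P ^ 2 * Q ^ 2 + 900 * x * P * Q ^ 3 - 225 * e * Q ^ 4 = 0 := by
    rw [← h0]; simp only [ofParams, comp]; ring
  obtain ⟨p, rfl⟩ : (15 : ℤ) ∣ P := by
    have h3 : (3 : ℤ) ∣ P := Int.prime_three.dvd_of_dvd_pow (n := 4)
      ⟨10 * c * P ^ 2 * Q ^ 2 - 300 * x * P * Q ^ 3 + 75 * e * Q ^ 4, by linear_combination h0'⟩
    have h5 : (5 : ℤ) ∣ P := Int.prime_five.dvd_of_dvd_pow (n := 4)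
      ⟨6 * c * P ^ 2 * Q ^ 2 - 180 * x * P * Q ^ 3 + 45 * e * Q ^ 4, by linear_combination h0'⟩
    omega
  have h1 : e * Q ^ 4 = 5 * (45 * p ^ 4 - 6 * c * p ^ 2 * Q ^ 2 + 12 * x * p * Q ^ 3) :=
    mul_left_cancel₀ (by norm_num : (225 : ℤ) ≠ 0) (by linear_combination -h0')
  obtain ⟨q, rfl⟩ := Int.prime_five.dvd_of_dvd_pow
    ((Int.prime_five.dvd_or_dvd ⟨_, h1⟩).resolve_left he)
  have : 5 * (3 * p * S - R * q) = 1 := by linear_combination h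
  omega

/-- The conclusion of reduction theory for the forms `ofParams c x e`. -/
structure IsReduced (G : BinaryQuartic) (N : ℤ) : Prop extends G.IsAdmissible N where
  isLead : BinaryQuartic.isLead G.a = true
  a_pos : 0 < G.a
  a_lt : G.a < 240
  hess_a : ∃ k : ℤ, G.hess.a = 240 * k ∧ -7 * G.a ≤ k ∧ k < 3 * G.a + 35
  lt_b : -2 * G.a < G.b
  b_le : G.b ≤ 2 * G.a

theorem exists_isReduced {c x e N : ℤ} (h : (ofParams c x e).IsAdmissible N) (he : ¬ 5 ∣ e) :
    ∃ G : BinaryQuartic, G.IsReduced N := by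
  have hroot : ∃ z : ℂ, z ^ 4 + ((-30 * c : ℝ) : ℂ) * z ^ 2 + ((900 * x : ℝ) : ℂ) * z +
      ((-225 * e : ℝ) : ℂ) = 0 ∧ 0 < z.im := by
    refine exists_root_im_pos ?_
    have hI : (12 * (-225 * e) + (-30 * c) ^ 2 : ℝ) = 25200 := by
      have h1 := h.invI_eq
      simp only [ofParams, invI] at h1
      have h2 : (12 * (-225 * e) + (-30 * c) ^ 2 : ℤ) = 25200 := by linear_combination h1
      exact_mod_cast h2
    have hJ : (72 * (-30 * c) * (-225 * e) - 27 * (900 * x) ^ 2 - 2 * (-30 * c) ^ 3 : ℝ) =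
        -17550000 := by
      have h1 := h.invJ_eq
      simp only [ofParams, invJ] at h1
      have h2 : (72 * (-30 * c) * (-225 * e) - 27 * (900 * x) ^ 2 - 2 * (-30 * c) ^ 3 : ℤ) =
        -17550000 := by linear_combination h1
      exact_mod_cast h2
    rw [hI, hJ]
    norm_num
  obtain ⟨z, hz, him⟩ := hroot
  obtain ⟨P, R, Q, S, hdet, w, hw, h0⟩ := (ofParams c x e).exists_comp_root him (by
    simp only [ofParams, eval]
    push_cast at hz ⊢
    linear_combination hz)
  have hG := h.comp hdet
  have hlead := isLead_comp c x e P R Q S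
  have ha := comp_a_ne_zero (c := c) (x := x) he hdet
  generalize (ofParams c x e).comp P R Q S = G at *
  obtain ⟨k, hk⟩ := hG.dvd_hess.1
  obtain ⟨hlo, hhi, hbd⟩ := bounds_of_root hG.invI_eq hG.invJ_eq hw h0 hk ha
  have hpos : 0 < G.a := by
    simp only [isLead, Bool.and_eq_true, Bool.or_eq_true, beq_iff_eq] at hlead
    omega
  obtain ⟨hk₁, hk₂⟩ := hbd hpos
  have hb := Int.emod_add_mul_ediv (G.b + 2 * G.a - 1) (4 * G.a)
  have hb₀ := Int.emod_nonneg (G.b + 2 * G.a - 1) (by omega : 4 * G.a ≠ 0)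
  have hb₁ := Int.emod_lt_of_pos (G.b + 2 * G.a - 1) (by omega : 0 < 4 * G.a)
  set j := (G.b + 2 * G.a - 1) / (4 * G.a)
  have hcomp := hG.comp (P := 1) (R := -j) (Q := 0) (S := 1) (by norm_num)
  have hca : (G.comp 1 (-j) 0 1).a = G.a := by simp [comp]
  have hcb : (G.comp 1 (-j) 0 1).b = G.b - 4 * G.a * j := by simp [comp]; ring
  refine ⟨G.comp 1 (-j) 0 1, hcomp, ?_, ?_, ?_, ⟨k, ?_, ?_, ?_⟩, ?_, ?_⟩
  · rwa [hca]
  · rwa [hca]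
  · rw [hca]; omega
  · rw [G.hess_comp (by norm_num), ← hk]
    simp [comp]
  · rwa [hca]
  · rw [hca]; omega
  · rw [hca, hcb]; omega
  · rw [hca, hcb]; omega

end BinaryQuartic

/-- Moduli `n` together with the bit mask of the squares modulo `n`. -/
def squareMasks : List (ℕ × ℕ) :=
  [(64, 144680414395695635), (63, 288872697407275667), (65, 20863489977805260307), (11, 571),
   (17, 107287), (19, 199411), (23, 340831), (29, 332473075), (31, 303908791), (37, 96068509339),
   (41, 1870503675703), (43, 3678700564051), (47, 4626135339999), (53, 5310023542746835),
   (59, 156326468341437115), (71, 20052041432995567487)]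

/-- A test that every perfect square passes. -/
def maybeSquare (s : ℕ) : Bool :=
  squareMasks.all fun t => t.2.testBit (s % t.1)

theorem maybeSquare_sq (s : ℕ) : maybeSquare (s ^ 2) = true := by
  have key : ∀ t ∈ squareMasks, 0 < t.1 ∧ ∀ r < t.1, t.2.testBit (r ^ 2 % t.1) = true := by
    decide +kernel
  simp only [maybeSquare, List.all_eq_true]
  intro t ht
  rw [Nat.pow_mod]
  exact (key t ht).2 _ (Nat.mod_lt _ (key t ht).1)

namespace BinaryQuartic

/-- The triples `(a, h, s)` with `0 < a < 240` a possible leading coefficient, `h` in the range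
given by reduction, and `s² = 5(4h³ - 84a²h + 325a³)`. -/
def syzygySolutions : List (ℤ × ℤ × ℤ) :=
  [(1, -5, 35), (1, -4, 45), (1, -1, 45), (1, 1, 35), (1, 4, 35), (1, 5, 45), (1, 14, 225),
   (1, 26, 585), (16, -91, 1170), (16, -80, 2240), (16, -64, 2880), (16, -16, 2880),
   (16, 16, 2240), (16, 20, 2160), (16, 64, 2240), (16, 80, 2880), (25, -145, 1575),
   (25, -125, 4375), (25, -100, 5625), (25, -70, 6075), (25, -25, 5625), (25, 25, 4375),
   (25, 70, 3725), (25, 80, 3825), (25, 100, 4375), (36, -211, 1670), (36, -180, 7560),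
   (36, -144, 9720), (36, -36, 9720), (36, 36, 7560), (36, 45, 7290), (36, 80, 6520),
   (81, -405, 25515), (81, -324, 32805), (81, -274, 34745), (81, -81, 32805), (81, 81, 25515),
   (81, 180, 22005), (100, -580, 12600), (100, -500, 35000), (100, -400, 45000),
   (100, -280, 48600), (100, -100, 45000), (100, 5, 40050), (100, 100, 35000), (100, 125, 33750),
   (100, 280, 29800), (100, 320, 30600), (121, -655, 35865), (121, -634, 40995),
   (121, -605, 46585), (121, -484, 59895), (121, -296, 64655), (121, -121, 59895),
   (121, 121, 46585), (126, -189, 66150), (136, 5, 63630), (196, -980, 96040),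
   (196, -784, 123480), (196, -316, 129240), (196, -196, 123480), (196, 196, 96040),
   (196, 245, 92610), (196, 404, 83880), (196, 584, 82440), (216, -459, 153090),
   (225, -1305, 42525), (225, -1125, 118125), (225, -900, 151875), (225, -630, 164025),
   (225, -225, 151875), (225, 225, 118125), (225, 500, 101875), (225, 630, 100575)]

theorem syzygySolutions_complete : ((List.range 240).all fun i => !isLead i || i == 0 ||
    (List.range (10 * i + 35)).all fun j =>
      Nat.blt (20 * j ^ 3 + 2520 * i ^ 2 * j) (420 * i * j ^ 2 + 2295 * i ^ 3) ||
      !maybeSquare (20 * j ^ 3 + 2520 * i ^ 2 * j - (420 * i * j ^ 2 + 2295 * i ^ 3)) ||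
      syzygySolutions.any fun t => t.1 == i && t.2.1 == j - 7 * i) = true := by
  decide +kernel

theorem syzygySolutions_sound : ∀ t ∈ syzygySolutions,
    t.2.2 ^ 2 = 5 * (4 * t.2.1 ^ 3 - 84 * t.1 ^ 2 * t.2.1 + 325 * t.1 ^ 3) := by
  decide +kernel

theorem mem_syzygySolutions {a k s : ℤ} (ha : 0 < a) (ha' : a < 240) (hlead : isLead a = true)
    (hk : -7 * a ≤ k) (hk' : k < 3 * a + 35)
    (hs : s ^ 2 = 5 * (4 * k ^ 3 - 84 * a ^ 2 * k + 325 * a ^ 3)) :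
    ∃ s', (a, k, s') ∈ syzygySolutions ∧ (s = s' ∨ s = -s') := by
  obtain ⟨i, rfl⟩ := Int.eq_ofNat_of_zero_le ha.le
  obtain ⟨j, hj⟩ := Int.eq_ofNat_of_zero_le (show 0 ≤ k + 7 * i by omega)
  obtain rfl : k = j - 7 * i := by omega
  have hs' : s.natAbs ^ 2 + (420 * i * j ^ 2 + 2295 * i ^ 3) =
      20 * j ^ 3 + 2520 * i ^ 2 * j := by
    zify
    rw [sq_abs, hs]
    ring
  have h1 := List.all_eq_true.1 syzygySolutions_complete i (List.mem_range.2 (by omega))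
  simp only [hlead, Bool.not_true, Bool.false_or, Bool.or_eq_true, beq_iff_eq]
    at h1
  have h1' := List.all_eq_true.1 (h1.resolve_left (by omega)) j (List.mem_range.2 (by omega))
  rw [← hs', Nat.add_sub_cancel, maybeSquare_sq] at h1'
  simp only [Bool.not_true, Bool.or_false, Bool.or_eq_true, Nat.blt_eq] at h1'
  obtain ⟨⟨a', k', s'⟩, hmem, h2⟩ := List.any_eq_true.1 (h1'.resolve_left (by omega))
  simp only [Bool.and_eq_true, beq_iff_eq] at h2
  obtain ⟨rfl, rfl⟩ := h2
  exact ⟨s', hmem, sq_eq_sq_iff_eq_or_eq_neg.1 (hs.trans (syzygySolutions_sound _ hmem).symm)⟩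

/-- Representatives, up to `y ↦ -y`, of the reduced forms satisfying the local conditions. -/
def reducedForms : List BinaryQuartic :=
  [⟨1, 0, 120, 900, 900⟩, ⟨1, 0, 30, 900, 2025⟩, ⟨1, 0, -150, 900, 225⟩,
   ⟨1, 0, -420, 4500, -12600⟩, ⟨1, 0, -780, 11700, -48600⟩, ⟨16, 20, 180, 200, 25⟩,
   ⟨25, 0, 120, 180, 36⟩, ⟨25, 0, 30, 180, 81⟩, ⟨81, 144, 246, 84, 1⟩, ⟨100, 100, 0, -80, 1⟩,
   ⟨121, 152, 234, 68, 1⟩, ⟨136, 116, 36, -64, 1⟩, ⟨216, 108, 84, -48, 1⟩, ⟨81, 36, -24, -84, 16⟩,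
   ⟨121, 232, 324, 148, 16⟩]

/-- The form `G(x, -y)`. -/
def reflect (G : BinaryQuartic) : BinaryQuartic := ⟨G.a, -G.b, G.c, -G.d, G.e⟩

/-- The covariant divided by its content `240`. -/
def hessRed (G : BinaryQuartic) : BinaryQuartic :=
  ⟨G.hess.a / 240, G.hess.b / 240, G.hess.c / 240, G.hess.d / 240, G.hess.e / 240⟩

/-- Whether `G = 1` and `H ∈ T` has a common solution modulo `r`. -/
def solvableMod (G H : BinaryQuartic) (r : ℕ) (T : List ℤ) : Bool :=
  (List.range r).any fun p => (List.range r).any fun q =>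
    G.eval (p : ℤ) (q : ℤ) % r == 1 && T.contains (H.eval (p : ℤ) (q : ℤ) % r)

theorem solvableMod_of_eval {G H : BinaryQuartic} {r : ℕ} (hr : 1 < r) {T : List ℤ} {p q : ℤ}
    (hG : G.eval p q = 1) (hH : H.eval p q % r ∈ T) : solvableMod G H r T = true := by
  have hr' : (0 : ℤ) < r := by omega
  have hmod : ∀ F : BinaryQuartic, F.eval (p % r) (q % r) % (r : ℤ) = F.eval p q % r := fun F => by
    have hp : p % r ≡ p [ZMOD r] := Int.mod_modEq p r
    have hq : q % r ≡ q [ZMOD r] := Int.mod_modEq q r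
    change _ ≡ _ [ZMOD r]
    simp only [eval]
    gcongr
  simp only [solvableMod, List.any_eq_true, Bool.and_eq_true, beq_iff_eq, List.contains_iff_mem,
    List.mem_range]
  have hp := Int.emod_nonneg p hr'.ne'
  have hq := Int.emod_nonneg q hr'.ne'
  have hp' := Int.emod_lt_of_pos p hr'
  have hq' := Int.emod_lt_of_pos q hr'
  refine ⟨(p % r).toNat, by omega, (q % r).toNat, by omega, ?_⟩
  rw [Int.toNat_of_nonneg hp, Int.toNat_of_nonneg hq, hmod, hmod, hG]
  exact ⟨Int.emod_eq_of_lt (by norm_num) (by omega), hH⟩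

/-- Whether a form is excluded by a divisibility or local condition, or listed. -/
def isExcludedOrListed (G : BinaryQuartic) : Bool :=
  !(G.hess.a % 240 == 0 && G.hess.b % 240 == 0 && G.hess.c % 240 == 0 && G.hess.d % 240 == 0 &&
    G.hess.e % 240 == 0) || !solvableMod G G.hessRed 3 [2] ||
    !solvableMod G G.hessRed 5 [0, 1, 4] ||
    reducedForms.contains G || reducedForms.contains G.reflect

/-- Reconstruct the last two coefficients from `a`, `b`, `c` and the square root `160s` of the
syzygy, and test the form. -/
def testForm (a b c s : ℤ) : Bool :=
  let d := (160 * s - b ^ 3 + 4 * a * b * c) / (8 * a ^ 2)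
  8 * a ^ 2 * d != 160 * s - b ^ 3 + 4 * a * b * c ||
    let e := (25200 + 3 * b * d - c ^ 2) / (12 * a)
    12 * a * e != 25200 + 3 * b * d - c ^ 2 || isExcludedOrListed ⟨a, b, c, d, e⟩

theorem testForm_of_mem : (syzygySolutions.all fun t => decide (0 < t.1) &&
    (List.range (4 * t.1).toNat).all fun i =>
      (3 * (i - 2 * t.1 + 1) ^ 2 - 240 * t.2.1) % (8 * t.1) != 0 ||
        let c := (3 * (i - 2 * t.1 + 1) ^ 2 - 240 * t.2.1) / (8 * t.1)
        testForm t.1 (i - 2 * t.1 + 1) c t.2.2 &&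
          testForm t.1 (i - 2 * t.1 + 1) c (-t.2.2)) = true := by
  decide +kernel

theorem IsReduced.mem_reducedForms {G : BinaryQuartic} {N : ℤ} (hG : G.IsReduced N)
    (h3 : N % 3 = 2) (h5 : N % 5 ∈ [0, 1, 4]) : G ∈ reducedForms ∨ G.reflect ∈ reducedForms := by
  obtain ⟨h, hh, hh₁, hh₂⟩ := hG.hess_a
  have ha := hG.a_pos
  have hsyz := G.syzygy
  rw [hG.invI_eq, hG.invJ_eq, hh] at hsyz
  obtain ⟨s, hs⟩ : ∃ s, G.b ^ 3 + 8 * G.a ^ 2 * G.d - 4 * G.a * G.b * G.c = 160 * s := by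
    have h1 : (160 : ℤ) ^ 2 ∣ (G.b ^ 3 + 8 * G.a ^ 2 * G.d - 4 * G.a * G.b * G.c) ^ 2 :=
      ⟨5 * (4 * h ^ 3 - 84 * G.a ^ 2 * h + 325 * G.a ^ 3), by linarith⟩
    exact (Int.pow_dvd_pow_iff two_ne_zero).1 h1
  rw [hs] at hsyz
  obtain ⟨s', hmem, hs'⟩ := mem_syzygySolutions ha hG.a_lt hG.isLead hh₁ hh₂
    (s := s) (by linarith)
  have hc : 8 * G.a * G.c = 3 * G.b ^ 2 - 240 * h := by
    simp only [hess] at hh; linarith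
  have hd : 8 * G.a ^ 2 * G.d = 160 * s - G.b ^ 3 + 4 * G.a * G.b * G.c := by linarith
  have he : 12 * G.a * G.e = 25200 + 3 * G.b * G.d - G.c ^ 2 := by
    have := hG.invI_eq
    simp only [invI] at this; linarith
  have hc' : (3 * G.b ^ 2 - 240 * h) / (8 * G.a) = G.c := by
    rw [← hc]; exact Int.mul_ediv_cancel_left _ (by omega)
  have hd' : (160 * s - G.b ^ 3 + 4 * G.a * G.b * G.c) / (8 * G.a ^ 2) = G.d := by
    rw [← hd]; exact Int.mul_ediv_cancel_left _ (by positivity)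
  have he' : (25200 + 3 * G.b * G.d - G.c ^ 2) / (12 * G.a) = G.e := by
    rw [← he]; exact Int.mul_ediv_cancel_left _ (by omega)
  have hc₀ : (3 * G.b ^ 2 - 240 * h) % (8 * G.a) = 0 := by
    rw [← hc]; exact Int.mul_emod_right _ _
  have hall := List.all_eq_true.1 testForm_of_mem _ hmem
  simp only [Bool.and_eq_true, decide_eq_true_eq] at hall
  have hlt := hG.lt_b
  have hle := hG.b_le
  have hi := List.all_eq_true.1 hall.2 (G.b + 2 * G.a - 1).toNat (List.mem_range.2 (by omega))
  rw [Int.toNat_of_nonneg (by omega),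
    show G.b + 2 * G.a - 1 - 2 * G.a + 1 = G.b by ring] at hi
  simp only [hc₀, hc', bne_self_eq_false, Bool.false_or, Bool.and_eq_true] at hi
  have htest : testForm G.a G.b G.c s = true := by
    rcases hs' with rfl | rfl
    exacts [hi.1, hi.2]
  simp only [testForm, hd', hd, he', he, bne_self_eq_false, Bool.false_or] at htest
  obtain ⟨p, q, hp, hq⟩ := hG.exists_eval
  obtain ⟨d1, d2, d3, d4, d5⟩ := hG.dvd_hess
  have hH : G.hessRed.eval p q = N := by
    refine mul_left_cancel₀ (by norm_num : (240 : ℤ) ≠ 0) (Eq.trans ?_ hq)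
    rw [eq_comm, eval, ← Int.mul_ediv_cancel' d1, ← Int.mul_ediv_cancel' d2,
      ← Int.mul_ediv_cancel' d3, ← Int.mul_ediv_cancel' d4, ← Int.mul_ediv_cancel' d5]
    simp only [eval, hessRed]
    push_cast
    ring
  have hs3 := solvableMod_of_eval (r := 3) (T := [2]) (by norm_num) hp (H := G.hessRed)
    (by rw [hH]; simpa using h3)
  have hs5 := solvableMod_of_eval (r := 5) (T := [0, 1, 4]) (by norm_num) hp (H := G.hessRed)
    (by rw [hH]; simpa using h5)
  simp only [isExcludedOrListed, hs3, hs5, Int.emod_eq_zero_of_dvd d1, Int.emod_eq_zero_of_dvd d2,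
    Int.emod_eq_zero_of_dvd d3, Int.emod_eq_zero_of_dvd d4, Int.emod_eq_zero_of_dvd d5] at htest
  simpa using htest

/-- The form represents `1` at a point where the covariant has the value `240N`. -/
def Represents (G : BinaryQuartic) (N : ℤ) : Prop :=
  ∃ p q : ℤ, G.eval p q = 1 ∧ G.hess.eval p q = 240 * N

theorem Represents.comp {G : BinaryQuartic} {N : ℤ} (hG : G.Represents N) {P R Q S : ℤ}
    (h : (P * S - R * Q) ^ 2 = 1) : (G.comp P R Q S).Represents N := by
  obtain ⟨p, q, h1, h2⟩ := hG
  have h4 : (P * S - R * Q) ^ 4 = 1 := by rw [show 4 = 2 * 2 from rfl, pow_mul, h, one_pow]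
  exact ⟨S * p - R * q, P * q - Q * p, by rw [eval_comp_adj, h4, h1, one_mul],
    by rw [hess_comp _ h, eval_comp_adj, h4, h2, one_mul]⟩

theorem Represents.of_reflect {G : BinaryQuartic} {N : ℤ} (hG : G.Represents N) :
    G.reflect.Represents N := by
  have := hG.comp (P := 1) (R := 0) (Q := 0) (S := -1) (by norm_num)
  rwa [show G.comp 1 0 0 (-1) = G.reflect by ext <;> simp [BinaryQuartic.comp, reflect]] at this

/-- Substitutions taking the reduced forms to standard ones. -/
def substitutions : List (ℤ × ℤ × ℤ × ℤ) :=
  [(1, 0, 0, 1), (1, -40, -1, 41), (1, -39, -1, 40), (1, -138, -2, 275), (0, -1, -1, 21),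
    (0, 1, -1, 20), (0, -1, -1, 17), (0, 1, -1, 16), (0, 1, -1, 12), (1, 2, 1, 3),
    (1, -2, 1, -3), (1, -2, -2, 5), (1, 2, -2, -5)]

theorem exists_substitution : ∀ G ∈ reducedForms, ∃ M ∈ substitutions,
    (M.1 * M.2.2.2 - M.2.1 * M.2.2.1) ^ 2 = 1 ∧
    (G.comp M.1 M.2.1 M.2.2.1 M.2.2.2 = ⟨25, 0, -780, 2340, -1944⟩ ∨
      ∃ t ∈ QuarticOrder.standardForms,
        G.comp M.1 M.2.1 M.2.2.1 M.2.2.2 = ofParams t.1 t.2.1 t.2.2) := by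
  decide +kernel

theorem Represents.exists_standardForm {G : BinaryQuartic} {N : ℤ} (hG : G.Represents N)
    (hmem : G ∈ reducedForms) : ∃ t ∈ QuarticOrder.standardForms,
      (ofParams t.1 t.2.1 t.2.2).Represents N := by
  obtain ⟨M, -, hdet, hM | ⟨t, ht, hM⟩⟩ := exists_substitution G hmem
  · obtain ⟨p, q, h1, -⟩ := hG.comp hdet
    rw [hM] at h1
    refine absurd ?_ (QuarticOrder.companion_ne_one p q)
    simp only [eval] at h1
    push_cast at h1
    linear_combination h1
  · exact ⟨t, ht, hM ▸ hG.comp hdet⟩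

theorem hess_ofParams_eval (c x e p q : ℤ) :
    (ofParams c x e).hess.eval p q = 240 * QuarticOrder.covariant c x e p q := by
  simp only [ofParams, hess, eval, QuarticOrder.covariant]
  push_cast
  ring

end BinaryQuartic

theorem binom_4_6_no_collisions (n m : ℕ) (hn : 8 ≤ n) (hm : 12 ≤ m) :
    Nat.choose n 4 ≠ Nat.choose m 6 := by
  intro hchoose
  have h := curve_of_choose_eq (by omega) (by omega) hchoose
  obtain ⟨y, hy⟩ : ∃ y : ℤ, 2 * y = (m : ℤ) ^ 2 - 5 * m := by
    obtain ⟨k, hk⟩ := Int.even_mul_succ_self (m : ℤ)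
    exact ⟨k - 3 * m, by linarith⟩
  have hadm := BinaryQuartic.isAdmissible_ofParams (x := (n : ℤ) ^ 2 - 3 * n + 1) (y := y)
    (by rw [← hy] at h; linarith)
  have hN : (3 * y + 5) % 5 ∈ [0, 1, 4] := by
    have h25 : ∀ r ∈ QuarticOrder.residues25, (r.val : ℤ) % 5 ∈ [0, 1, 4] := by decide
    have := h25 _ (mem_residues25 hy h)
    rwa [ZMod.val_intCast, Int.emod_emod_of_dvd _ (by norm_num)] at this
  have he : ¬ (5 : ℤ) ∣ 3 * y ^ 2 + 10 * y - 1 := by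
    obtain ⟨j, hj⟩ : ∃ j, y ^ 2 = 5 * j ∨ y ^ 2 = 5 * j + 1 ∨ y ^ 2 = 5 * j + 4 := by
      obtain ⟨k, hk⟩ : ∃ k, y = 5 * k ∨ y = 5 * k + 1 ∨ y = 5 * k - 1 ∨ y = 5 * k + 2 ∨
        y = 5 * k - 2 := ⟨(y + 2) / 5, by omega⟩
      exact ⟨y ^ 2 / 5, by
        rcases hk with rfl | rfl | rfl | rfl | rfl <;> ring_nf <;> omega⟩
    omega
  obtain ⟨G, hG⟩ := BinaryQuartic.exists_isReduced hadm he
  have hrep : ∃ F ∈ BinaryQuartic.reducedForms, F.Represents (3 * y + 5) := by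
    rcases hG.mem_reducedForms (by omega) hN with hmem | hmem
    exacts [⟨G, hmem, hG.exists_eval⟩,
      ⟨_, hmem, BinaryQuartic.Represents.of_reflect hG.exists_eval⟩]
  obtain ⟨F, hF, hrepF⟩ := hrep
  obtain ⟨⟨c, x, e⟩, ht, p, q, h1, h2⟩ := hrepF.exists_standardForm hF
  rw [BinaryQuartic.hess_ofParams_eval] at h2
  refine false_of_mem_standardForms (by exact_mod_cast hm) (by exact_mod_cast hn) hy h ht
    (p := p) (q := q) ?_ (by linarith)
  simp only [BinaryQuartic.ofParams, BinaryQuartic.eval] at h1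
  push_cast at h1
  linear_combination h1
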